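/- arXiv:1412.1911 — 3 statements merged into one kernel-verified Lean document; each statement's English description precedes it below -/
import Mathlib

section
/- (Non-ergodic iteration-complexity, KKT residual.) Suppose a KKT point exists, ∇f and ∇g are Lipschitz continuous, the mean-value hypothesis holds, τ ∈ (0, (1+√5)/2), and for some α ∈ (τ/min(1+τ, 1+τ⁻¹), 1]: Σ̂_f + S ⪰ 0, H_f ≻ 0, (1/2)Σ̂_g + T ⪰ 0 and M_g ≻ 0. Define ∂p(x) := {v ∈ X : ∀u ∈ X, p(u) ≥ p(x) + ⟨v, u − x⟩} and similarly ∂q(y) ⊆ Y. Then k · min_{1 ≤ i ≤ k} { d(0, ∂p(x^{i+1}) + ∇f(x^{i+1}) + A z^{i+1})² + d(0, ∂q(y^{i+1}) + ∇g(y^{i+1}) + B z^{i+1})² + ‖A*x^{i+1} + B*y^{i+1} − c‖² } → 0 as k → ∞, where d(0, S) denotes the Euclidean distance from the origin to the set S and the sums of a set with a vector are translates of the set. -/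
open scoped RealInnerProductSpace

theorem aux_kmin (a : ℕ → ℝ) (ha : ∀ i, 0 ≤ a i) (hs : Summable a) :
    Filter.Tendsto (fun k : ℕ => (k : ℝ) * sInf (a '' Set.Icc 1 k)) Filter.atTop (nhds 0) := by
  have hT := hs.hasSum.tendsto_sum_nat
  have h1 : Filter.Tendsto (fun k : ℕ => ∑ i ∈ Finset.range (k + 1), a i) Filter.atTop
      (nhds (∑' i, a i)) := hT.comp (Filter.tendsto_add_atTop_nat 1)
  have h2 : Filter.Tendsto (fun k : ℕ => ∑ i ∈ Finset.range (k / 2 + 1), a i) Filter.atTop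
      (nhds (∑' i, a i)) := h1.comp (Nat.tendsto_div_const_atTop (by norm_num))
  have h3 := (h1.sub h2).const_mul 2
  rw [sub_self, mul_zero] at h3
  refine squeeze_zero (fun k => ?_) (fun k => ?_) h3
  · refine mul_nonneg (Nat.cast_nonneg k) (Real.sInf_nonneg ?_)
    rintro _ ⟨i, -, rfl⟩
    exact ha i
  · have hm : ∀ i ∈ Finset.Ico (k / 2 + 1) (k + 1), sInf (a '' Set.Icc 1 k) ≤ a i := by
      intro i hi
      rw [Finset.mem_Ico] at hi
      refine csInf_le ⟨0, ?_⟩ ⟨i, ⟨by omega, by omega⟩, rfl⟩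
      rintro _ ⟨i, -, rfl⟩
      exact ha i
    have h0 : 0 ≤ sInf (a '' Set.Icc 1 k) := by
      refine Real.sInf_nonneg ?_
      rintro _ ⟨i, -, rfl⟩
      exact ha i
    have h4 := Finset.card_nsmul_le_sum _ _ _ hm
    rw [Nat.card_Ico, Finset.sum_Ico_eq_sub _ (by omega), nsmul_eq_mul] at h4
    have h5 : (k : ℝ) ≤ 2 * ((k + 1 - (k / 2 + 1) : ℕ) : ℝ) := by
      have : k ≤ 2 * (k + 1 - (k / 2 + 1)) := by omega
      exact_mod_cast this
    nlinarith [mul_le_mul_of_nonneg_right h5 h0]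

theorem aux_coer {X : Type*} [NormedAddCommGroup X] [InnerProductSpace ℝ X]
    [FiniteDimensional ℝ X] (H : X →ₗ[ℝ] X) (hH : ∀ u : X, u ≠ 0 → 0 < ⟪u, H u⟫) :
    ∃ m : ℝ, 0 < m ∧ ∀ u : X, m * ‖u‖ ^ 2 ≤ ⟪u, H u⟫ := by
  by_cases hne : (Metric.sphere (0 : X) 1).Nonempty
  · have hc : Continuous (fun u : X => ⟪u, H u⟫) :=
      continuous_id.inner H.continuous_of_finiteDimensional
    have : ProperSpace X := FiniteDimensional.proper_real X
    obtain ⟨v, hv, hmin⟩ := (isCompact_sphere (0 : X) 1).exists_isMinOn hne hc.continuousOn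
    have hv0 : v ≠ 0 := by
      rintro rfl
      simp at hv
    refine ⟨⟪v, H v⟫, hH v hv0, fun u => ?_⟩
    by_cases hu : u = 0
    · simp [hu]
    · have hn : 0 < ‖u‖ := norm_pos_iff.mpr hu
      have : ⟪v, H v⟫ ≤ ⟪‖u‖⁻¹ • u, H (‖u‖⁻¹ • u)⟫ :=
        hmin (a := ‖u‖⁻¹ • u) (by simp [norm_smul, hn.ne'])
      rw [map_smul, real_inner_smul_left, real_inner_smul_right] at this
      have h2 := mul_le_mul_of_nonneg_right this (sq_nonneg ‖u‖)
      have h3 : ‖u‖⁻¹ * (‖u‖⁻¹ * ⟪u, H u⟫) * ‖u‖ ^ 2 = ⟪u, H u⟫ := by field_simp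
      linarith
  · refine ⟨1, one_pos, fun u => ?_⟩
    have hu : u = 0 := by
      by_contra hu
      exact hne ⟨‖u‖⁻¹ • u, by simp [norm_smul, norm_ne_zero_iff.mpr hu]⟩
    simp [hu]

theorem aux_ereal (a b : EReal) (r s : ℝ) (ha : a ≠ ⊤) (ha' : a ≠ ⊥) (hb : b ≠ ⊤) (hb' : b ≠ ⊥)
    (h1 : a + (r : EReal) ≤ b) (h2 : b + (s : EReal) ≤ a) : r + s ≤ 0 := by
  lift a to ℝ using ⟨ha, ha'⟩
  lift b to ℝ using ⟨hb, hb'⟩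
  norm_cast at h1 h2
  linarith

theorem aux_three {X : Type*} [NormedAddCommGroup X] [InnerProductSpace ℝ X]
    (G : X →ₗ[ℝ] X) (hG : ∀ u v : X, ⟪G u, v⟫ = ⟪u, G v⟫) (a b c : X) :
    ⟪a - c, G (a - b)⟫ = (1/2) * (⟪a - c, G (a - c)⟫ - ⟪b - c, G (b - c)⟫ + ⟪a - b, G (a - b)⟫) := by
  have e1 := hG a b
  have e2 := hG a c
  have e3 := hG b c
  rw [real_inner_comm] at e1 e2 e3
  simp only [map_sub, inner_sub_left, inner_sub_right]
  linarith

theorem aux_half {X : Type*} [NormedAddCommGroup X] [InnerProductSpace ℝ X]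
    (G : X →ₗ[ℝ] X) (hG : ∀ u v : X, ⟪G u, v⟫ = ⟪u, G v⟫) (hp : ∀ u : X, 0 ≤ ⟪u, G u⟫)
    (a b c : X) :
    (1/4) * ⟪a - b, G (a - b)⟫ ≤ (1/2) * (⟪a - c, G (a - c)⟫ + ⟪b - c, G (b - c)⟫) := by
  have h := hp ((a - c) + (b - c))
  have e1 := hG a b
  have e2 := hG a c
  have e3 := hG b c
  rw [real_inner_comm] at e1 e2 e3
  simp only [map_sub, map_add, inner_sub_left, inner_sub_right, inner_add_left,
    inner_add_right] at *
  linarith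

theorem aux_block {X : Type*} [NormedAddCommGroup X] [InnerProductSpace ℝ X]
    (p : X → EReal) (hp_nebot : ∀ x, p x ≠ ⊥) (f : X → ℝ) (f' : X → X) (Sf Sfh S : X →ₗ[ℝ] X)
    (hSf_sym : ∀ u v : X, ⟪Sf u, v⟫ = ⟪u, Sf v⟫) (hSf_psd : ∀ u : X, 0 ≤ ⟪u, Sf u⟫)
    (hSfh_sym : ∀ u v : X, ⟪Sfh u, v⟫ = ⟪u, Sfh v⟫)
    (hS_sym : ∀ u v : X, ⟪S u, v⟫ = ⟪u, S v⟫)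
    (hf_low : ∀ x x' : X, f x' + ⟪x - x', f' x'⟫ + (1/2) * ⟪x - x', Sf (x - x')⟫ ≤ f x)
    (hf_up : ∀ x x' : X, f x ≤ f x' + ⟪x - x', f' x'⟫ + (1/2) * ⟪x - x', Sfh (x - x')⟫)
    (x x1 xb w wb : X) (h1 : p x1 ≠ ⊤) (hb : p xb ≠ ⊤)
    (hi : p x1 + ((⟪x1 - xb, f' x + w + (Sfh (x1 - x) + S (x1 - x))⟫ : ℝ) : EReal) ≤ p xb)
    (hk : p xb + ((⟪xb - x1, f' xb + wb⟫ : ℝ) : EReal) ≤ p x1) :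
    ⟪x1 - xb, w - wb⟫ + (1/2) * (⟪x1 - xb, (Sfh + S) (x1 - xb)⟫ - ⟪x - xb, (Sfh + S) (x - xb)⟫)
      + (1/2) * ⟪x1 - x, (1/2 : ℝ) • Sf (x1 - x) + S (x1 - x)⟫ ≤ 0 := by
  have h := aux_ereal _ _ _ _ h1 (hp_nebot _) hb (hp_nebot _) hi hk
  have t1 := aux_three Sfh hSfh_sym x1 x xb
  have t2 := aux_three S hS_sym x1 x xb
  have t3 := aux_half Sf hSf_sym hSf_psd x1 x xb
  have g1 := hf_low xb x
  have g2 := hf_up x1 x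
  have g3 := hf_low x1 xb
  have n1 : ⟪xb - x1, f' xb + wb⟫ = -⟪x1 - xb, f' xb⟫ - ⟪x1 - xb, wb⟫ := by
    rw [← neg_sub x1 xb, inner_neg_left, inner_add_right]; ring
  have n2 : ⟪xb - x, f' x⟫ = ⟪x1 - x, f' x⟫ - ⟪x1 - xb, f' x⟫ := by
    rw [← inner_sub_left]; congr 1; abel
  have n3 : ⟪xb - x, Sf (xb - x)⟫ = ⟪x - xb, Sf (x - xb)⟫ := by
    rw [← neg_sub x xb, map_neg, inner_neg_neg]
  rw [n1] at h
  rw [n2, n3] at g1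
  simp only [LinearMap.add_apply, inner_add_right, inner_sub_right, real_inner_smul_right] at h ⊢
  simp only [← inner_sub_right] at h ⊢
  rw [inner_sub_right]
  linarith

theorem aux_mult {Z : Type*} [NormedAddCommGroup Z] [InnerProductSpace ℝ Z]
    (σ τ : ℝ) (hσ : 0 < σ) (hτ : 0 < τ) (a b b0 r z zb : Z) (hr : r = a + b) :
    2 * (⟪a, z + σ • (a + b0) - zb⟫ + ⟪b, z + σ • r - zb⟫)
      = (1 / (τ * σ)) * (‖z + (τ * σ) • r - zb‖ ^ 2 - ‖z - zb‖ ^ 2)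
        + σ * (‖b‖ ^ 2 - ‖b0‖ ^ 2)
        + σ * ((2 - τ) * ‖r‖ ^ 2 - 2 * ⟪r, b - b0⟫ + ‖b - b0‖ ^ 2) := by
  subst hr
  have e : z + (τ * σ) • (a + b) - zb = (z - zb) + (τ * σ) • (a + b) := by abel
  have e2 : z + σ • (a + b0) - zb = (z - zb) + σ • (a + b0) := by abel
  have e3 : z + σ • (a + b) - zb = (z - zb) + σ • (a + b) := by abel
  rw [e, e2, e3]
  generalize z - zb = w
  simp only [← real_inner_self_eq_norm_sq, inner_add_left, inner_add_right, inner_sub_left,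
    inner_sub_right, real_inner_smul_left, real_inner_smul_right]
  rw [real_inner_comm a b, real_inner_comm b b0, real_inner_comm w a,
    real_inner_comm w b]
  field_simp
  ring

theorem aux_cross {Y : Type*} [NormedAddCommGroup Y] [InnerProductSpace ℝ Y]
    (Sgh T W : Y →ₗ[ℝ] Y)
    (hSgh_sym : ∀ u v : Y, ⟪Sgh u, v⟫ = ⟪u, Sgh v⟫)
    (hT_sym : ∀ u v : Y, ⟪T u, v⟫ = ⟪u, T v⟫)
    (hW_sym : ∀ u v : Y, ⟪W u, v⟫ = ⟪u, W v⟫)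
    (hW : ∀ u : Y, 0 ≤ ⟪u, W u⟫) (hW2 : ∀ u : Y, 0 ≤ ⟪u, Sgh u - W u⟫)
    (hhalf : ∀ u : Y, 0 ≤ ⟪u, (1/2 : ℝ) • Sgh u + T u⟫) (u v : Y) :
    ⟪u, Sgh v + T v - W v⟫ ≤ (1/2) * (⟪u, (Sgh + T) u⟫ + ⟪v, (Sgh + T) v⟫) := by
  have a1 := hW (u + v)
  have a2 := hW (u - v)
  have a3 := hW2 (u + v)
  have a4 := hW2 (u - v)
  have a5 := hhalf (u - v)
  have e1 := hSgh_sym u v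
  have e2 := hT_sym u v
  have e3 := hW_sym u v
  rw [real_inner_comm] at e1 e2 e3
  simp only [LinearMap.add_apply, map_sub, map_add, inner_sub_left, inner_sub_right, inner_add_left,
    inner_add_right, real_inner_smul_right] at *
  linarith

theorem aux_const (τ α : ℝ) (hτ : 0 < τ) 
    (hα1 : τ / min (1 + τ) (1 + τ⁻¹) < α) (hα2 : α ≤ 1) (hτub : τ < (1 + Real.sqrt 5) / 2) :
    ∃ c1 d : ℝ, 0 ≤ c1 ∧ 0 < d ∧ ∀ σ Φ Φ' dx dy Rn R N I J Ax G0 G1 : ℝ, 0 < σ →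
      dx + dy + σ * ((2 - τ) * Rn - 2 * I + N) ≤ Φ - Φ' →
      2 * σ * (I - (1 - τ) * J) ≤ G0 - G1 →
      2 * J ≤ R + N → - 2 * J ≤ τ * N + R / τ →
      Ax / 2 - R ≤ Rn - 2 * I + N →
      d * σ * Rn + (dx + (1/2) * (1 - α) * σ * Ax) + (dy + min τ (1 + τ - τ ^ 2) * α * σ * N)
        ≤ (Φ + c1 * σ * R + α * G0) - (Φ' + c1 * σ * Rn + α * G1) := by
  have hα0 : 0 < α := lt_of_le_of_lt (by positivity) hα1
  have hpos : 0 < min (1 + τ) (1 + τ⁻¹) := by positivity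
  rw [div_lt_iff₀ hpos] at hα1
  rcases le_total τ 1 with h | h
  · have hd : τ < α * (1 + τ) := hα1.trans_le (mul_le_mul_of_nonneg_left (min_le_left _ _) hα0.le)
    refine ⟨α * (1 - τ) + (1 - α), α - (1 - α) * τ, ?_, by linarith, ?_⟩
    · have := mul_nonneg hα0.le (sub_nonneg.mpr h); linarith
    · intro σ Φ Φ' dx dy Rn R N I J Ax G0 G1 hσ h1 h2 h3 h4 h5
      rw [min_eq_left (by nlinarith)]
      have k2 := mul_le_mul_of_nonneg_left h2 hα0.le
      have k3 := mul_le_mul_of_nonneg_left h3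
        (mul_nonneg (mul_nonneg hα0.le hσ.le) (sub_nonneg.mpr h))
      have k5 := mul_le_mul_of_nonneg_left h5 (mul_nonneg (sub_nonneg.mpr hα2) hσ.le)
      linarith
  · have hd : τ < α * (1 + τ⁻¹) :=
      hα1.trans_le (mul_le_mul_of_nonneg_left (min_le_right _ _) hα0.le)
    refine ⟨α * (1 - τ⁻¹) + (1 - α), α * (1 + τ⁻¹) - τ, ?_, by linarith, ?_⟩
    · have : τ⁻¹ ≤ 1 := inv_le_one_of_one_le₀ h
      have := mul_nonneg hα0.le (sub_nonneg.mpr this); linarith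
    · intro σ Φ Φ' dx dy Rn R N I J Ax G0 G1 hσ h1 h2 h3 h4 h5
      rw [min_eq_right (by nlinarith)]
      have k2 := mul_le_mul_of_nonneg_left h2 hα0.le
      have k4 := mul_le_mul_of_nonneg_left h4
        (mul_nonneg (mul_nonneg hα0.le hσ.le) (sub_nonneg.mpr h))
      have k5 := mul_le_mul_of_nonneg_left h5 (mul_nonneg (sub_nonneg.mpr hα2) hσ.le)
      have e : α * σ * (τ - 1) * (τ * N + R / τ)
          = α * σ * (τ ^ 2 - τ) * N + α * σ * (1 - τ⁻¹) * R := by field_simp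
      rw [e] at k4
      linarith

theorem aux_res {X Y Z : Type*}
    [NormedAddCommGroup X] [InnerProductSpace ℝ X] [FiniteDimensional ℝ X]
    [NormedAddCommGroup Y] [InnerProductSpace ℝ Y] [FiniteDimensional ℝ Y]
    [NormedAddCommGroup Z] [InnerProductSpace ℝ Z] [FiniteDimensional ℝ Z]
    (A : Z →ₗ[ℝ] X) (Bs : Y →ₗ[ℝ] Z) (Q : X →ₗ[ℝ] X) (f' : X → X)
    (hf'lip : ∃ L : NNReal, LipschitzWith L f') (σ τ : ℝ) :
    ∃ C : ℝ, 0 ≤ C ∧ ∀ (p : X → EReal) (x x1 : X) (d : Y) (z z1 r s : Z),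
      z1 = z + (τ * σ) • r → s = r - Bs d →
      (∀ u : X, p x1 + ((⟪x1 - u, f' x + A (z + σ • s) + Q (x1 - x)⟫ : ℝ) : EReal) ≤ p u) →
      (Metric.infDist (0 : X) ((fun v : X => v + (f' x1 + A z1)) ''
        {v : X | ∀ u : X, p x1 + ((⟪v, u - x1⟫ : ℝ) : EReal) ≤ p u})) ^ 2
      ≤ C * (‖x1 - x‖ ^ 2 + ‖d‖ ^ 2 + ‖r‖ ^ 2) := by
  obtain ⟨L, hL⟩ := hf'lip
  set c1 : ℝ := L + ‖LinearMap.toContinuousLinearMap Q‖ with hc1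
  set c2 : ℝ := |σ| * ‖LinearMap.toContinuousLinearMap (A ∘ₗ Bs)‖ with hc2
  set c3 : ℝ := |τ * σ - σ| * ‖LinearMap.toContinuousLinearMap A‖ with hc3
  refine ⟨3 * (c1 ^ 2 + c2 ^ 2 + c3 ^ 2), by positivity, ?_⟩
  intro p x x1 d z z1 r s hz hs hsub
  set v := -(f' x + A (z + σ • s) + Q (x1 - x)) with hv
  have hmem : v + (f' x1 + A z1) ∈ (fun v : X => v + (f' x1 + A z1)) ''
        {v : X | ∀ u : X, p x1 + ((⟪v, u - x1⟫ : ℝ) : EReal) ≤ p u} := by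
    refine ⟨v, fun u => ?_, rfl⟩
    have e : ⟪v, u - x1⟫ = ⟪x1 - u, f' x + A (z + σ • s) + Q (x1 - x)⟫ := by
      rw [hv, real_inner_comm, inner_neg_right, ← inner_neg_left, neg_sub]
    rw [e]
    exact hsub u
  have h1 := Metric.infDist_le_dist_of_mem (x := (0 : X)) hmem
  rw [dist_zero_left] at h1
  have e : v + (f' x1 + A z1) = (f' x1 - f' x) - Q (x1 - x) + σ • (A ∘ₗ Bs) d
      + (τ * σ - σ) • A r := by
    rw [hv, hz, hs]
    simp only [map_add, map_smul, map_sub, LinearMap.comp_apply, smul_sub, sub_smul]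
    abel
  have b1 : ‖f' x1 - f' x‖ ≤ L * ‖x1 - x‖ := hL.norm_sub_le x1 x
  have b2 : ‖Q (x1 - x)‖ ≤ ‖LinearMap.toContinuousLinearMap Q‖ * ‖x1 - x‖ :=
    (LinearMap.toContinuousLinearMap Q).le_opNorm _
  have b3 : ‖σ • (A ∘ₗ Bs) d‖ ≤ c2 * ‖d‖ := by
    rw [norm_smul, hc2, mul_assoc, Real.norm_eq_abs]
    exact mul_le_mul_of_nonneg_left ((LinearMap.toContinuousLinearMap (A ∘ₗ Bs)).le_opNorm _)
      (abs_nonneg _)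
  have b4 : ‖(τ * σ - σ) • A r‖ ≤ c3 * ‖r‖ := by
    rw [norm_smul, hc3, mul_assoc, Real.norm_eq_abs]
    exact mul_le_mul_of_nonneg_left ((LinearMap.toContinuousLinearMap A).le_opNorm _)
      (abs_nonneg _)
  have h2 : ‖v + (f' x1 + A z1)‖ ≤ c1 * ‖x1 - x‖ + c2 * ‖d‖ + c3 * ‖r‖ := by
    rw [e]
    have n1 := norm_add_le ((f' x1 - f' x) - Q (x1 - x) + σ • (A ∘ₗ Bs) d) ((τ * σ - σ) • A r)
    have n2 := norm_add_le ((f' x1 - f' x) - Q (x1 - x)) (σ • (A ∘ₗ Bs) d)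
    have n3 := norm_sub_le (f' x1 - f' x) (Q (x1 - x))
    rw [hc1]
    linarith
  have h3 := pow_le_pow_left₀ Metric.infDist_nonneg (h1.trans h2) 2
  refine h3.trans ?_
  generalize ‖x1 - x‖ = a
  generalize ‖d‖ = b
  generalize ‖r‖ = c
  nlinarith [sq_nonneg (c1 * a - c2 * b), sq_nonneg (c1 * a - c3 * c), sq_nonneg (c2 * b - c3 * c),
    sq_nonneg (c1 * b), sq_nonneg (c1 * c), sq_nonneg (c2 * a), sq_nonneg (c2 * c),
    sq_nonneg (c3 * a), sq_nonneg (c3 * b)]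

set_option maxHeartbeats 1000000 in
theorem stmt13
    {X Y Z : Type*}
    [NormedAddCommGroup X] [InnerProductSpace ℝ X] [FiniteDimensional ℝ X]
    [NormedAddCommGroup Y] [InnerProductSpace ℝ Y] [FiniteDimensional ℝ Y]
    [NormedAddCommGroup Z] [InnerProductSpace ℝ Z] [FiniteDimensional ℝ Z]
    (A : Z →ₗ[ℝ] X) (Astar : X →ₗ[ℝ] Z)
    (B : Z →ₗ[ℝ] Y) (Bstar : Y →ₗ[ℝ] Z)
    (hA : ∀ (z : Z) (x : X), ⟪A z, x⟫ = ⟪z, Astar x⟫)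
    (hB : ∀ (z : Z) (y : Y), ⟪B z, y⟫ = ⟪z, Bstar y⟫)
    (c : Z) (σ τ : ℝ) (hσ : 0 < σ) (hτ : 0 < τ)
    (p : X → EReal) (q : Y → EReal)
    (hp_proper : ∃ x, p x ≠ ⊤) (hp_nebot : ∀ x, p x ≠ ⊥)
    (hq_proper : ∃ y, q y ≠ ⊤) (hq_nebot : ∀ y, q y ≠ ⊥)
    (hp_convex : ∀ (x x' : X) (t : ℝ), 0 ≤ t → t ≤ 1 →
      p (t • x + (1 - t) • x') ≤ ((t : ℝ) : EReal) * p x + (((1 - t : ℝ)) : EReal) * p x')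
    (hq_convex : ∀ (y y' : Y) (t : ℝ), 0 ≤ t → t ≤ 1 →
      q (t • y + (1 - t) • y') ≤ ((t : ℝ) : EReal) * q y + (((1 - t : ℝ)) : EReal) * q y')
    (f : X → ℝ) (g : Y → ℝ) (f' : X → X) (g' : Y → Y)
    (hf : ∀ x, HasGradientAt f (f' x) x) (hg : ∀ y, HasGradientAt g (g' y) y)
    (hfc : ConvexOn ℝ Set.univ f) (hgc : ConvexOn ℝ Set.univ g)
    (Sf Sfh S : X →ₗ[ℝ] X) (Sg Sgh T : Y →ₗ[ℝ] Y)
    (hSf_sym : ∀ u v : X, ⟪Sf u, v⟫ = ⟪u, Sf v⟫) (hSf_psd : ∀ u : X, 0 ≤ ⟪u, Sf u⟫)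
    (hSfh_sym : ∀ u v : X, ⟪Sfh u, v⟫ = ⟪u, Sfh v⟫) (hSfh_psd : ∀ u : X, 0 ≤ ⟪u, Sfh u⟫)
    (hSfh_ge : ∀ u : X, ⟪u, Sf u⟫ ≤ ⟪u, Sfh u⟫)
    (hS_sym : ∀ u v : X, ⟪S u, v⟫ = ⟪u, S v⟫)
    (hSg_sym : ∀ u v : Y, ⟪Sg u, v⟫ = ⟪u, Sg v⟫) (hSg_psd : ∀ u : Y, 0 ≤ ⟪u, Sg u⟫)
    (hSgh_sym : ∀ u v : Y, ⟪Sgh u, v⟫ = ⟪u, Sgh v⟫) (hSgh_psd : ∀ u : Y, 0 ≤ ⟪u, Sgh u⟫)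
    (hSgh_ge : ∀ u : Y, ⟪u, Sg u⟫ ≤ ⟪u, Sgh u⟫)
    (hT_sym : ∀ u v : Y, ⟪T u, v⟫ = ⟪u, T v⟫)
    (hf_low : ∀ x x' : X, f x' + ⟪x - x', f' x'⟫ + (1/2) * ⟪x - x', Sf (x - x')⟫ ≤ f x)
    (hf_up : ∀ x x' : X, f x ≤ f x' + ⟪x - x', f' x'⟫ + (1/2) * ⟪x - x', Sfh (x - x')⟫)
    (hg_low : ∀ y y' : Y, g y' + ⟪y - y', g' y'⟫ + (1/2) * ⟪y - y', Sg (y - y')⟫ ≤ g y)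
    (hg_up : ∀ y y' : Y, g y ≤ g y' + ⟪y - y', g' y'⟫ + (1/2) * ⟪y - y', Sgh (y - y')⟫)
    (xk : ℕ → X) (yk : ℕ → Y) (zk : ℕ → Z)
    (hxdom : ∀ k, p (xk k) ≠ ⊤) (hydom : ∀ k, q (yk k) ≠ ⊤)
    (hiter_x : ∀ (k : ℕ) (x : X),
      p (xk (k + 1)) + ((⟪xk (k + 1) - x, f' (xk k)
        + A (zk k + σ • (Astar (xk (k + 1)) + Bstar (yk k) - c))
        + (Sfh (xk (k + 1) - xk k) + S (xk (k + 1) - xk k))⟫ : ℝ) : EReal) ≤ p x)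
    (hiter_y : ∀ (k : ℕ) (y : Y),
      q (yk (k + 1)) + ((⟪yk (k + 1) - y, g' (yk k)
        + B (zk k + σ • (Astar (xk (k + 1)) + Bstar (yk (k + 1)) - c))
        + (Sgh (yk (k + 1) - yk k) + T (yk (k + 1) - yk k))⟫ : ℝ) : EReal) ≤ q y)
    (hiter_z : ∀ k : ℕ, zk (k + 1) = zk k + (τ * σ) • (Astar (xk (k + 1)) + Bstar (yk (k + 1)) - c))

    (hKKT : ∃ (xb : X) (yb : Y) (zb : Z), p xb ≠ ⊤ ∧ q yb ≠ ⊤ ∧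
      (∀ x : X, p xb + ((⟪xb - x, f' xb + A zb⟫ : ℝ) : EReal) ≤ p x) ∧
      (∀ y : Y, q yb + ((⟪yb - y, g' yb + B zb⟫ : ℝ) : EReal) ≤ q y) ∧
      Astar xb + Bstar yb = c)

    (hMV : ∀ k : ℕ, 1 ≤ k → ∃ W : Y →ₗ[ℝ] Y,
      (∀ u v : Y, ⟪W u, v⟫ = ⟪u, W v⟫) ∧ (∀ u : Y, 0 ≤ ⟪u, W u⟫) ∧
      (∀ u : Y, 0 ≤ ⟪u, Sgh u - W u⟫) ∧
      g' (yk k) - g' (yk (k - 1)) = W (yk k - yk (k - 1)))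

    (hτub : τ < (1 + Real.sqrt 5) / 2)
    (α : ℝ) (hα1 : τ / min (1 + τ) (1 + τ⁻¹) < α) (hα2 : α ≤ 1)

    (hf'lip : ∃ L : NNReal, LipschitzWith L f') (hg'lip : ∃ L : NNReal, LipschitzWith L g')
    (hfsS : ∀ u : X, 0 ≤ ⟪u, Sfh u + S u⟫)
    (hHf : ∀ u : X, u ≠ 0 →
      0 < ⟪u, (1/2 : ℝ) • Sf u + S u + ((1/2) * (1 - α) * σ) • A (Astar u)⟫)
    (hhalf : ∀ u : Y, 0 ≤ ⟪u, (1/2 : ℝ) • Sgh u + T u⟫)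
    (hMg : ∀ u : Y, u ≠ 0 →
      0 < ⟪u, (1/2 : ℝ) • Sg u + T u + (min τ (1 + τ - τ ^ 2) * α * σ) • B (Bstar u)⟫) :
    Filter.Tendsto (fun k : ℕ => (k : ℝ) * sInf ((fun i : ℕ =>
        (Metric.infDist (0 : X)
          ((fun v : X => v + (f' (xk (i + 1)) + A (zk (i + 1)))) '' {v : X | ∀ u : X, p (xk (i + 1)) + ((⟪v, u - xk (i + 1)⟫ : ℝ) : EReal) ≤ p u})) ^ 2
        + (Metric.infDist (0 : Y)
          ((fun v : Y => v + (g' (yk (i + 1)) + B (zk (i + 1)))) '' {v : Y | ∀ u : Y, q (yk (i + 1)) + ((⟪v, u - yk (i + 1)⟫ : ℝ) : EReal) ≤ q u})) ^ 2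
        + ‖Astar (xk (i + 1)) + Bstar (yk (i + 1)) - c‖ ^ 2) '' Set.Icc 1 k))
      Filter.atTop (nhds 0) := by
  obtain ⟨xb, yb, zb, hpb, hqb, hkx, hky, hc⟩ := hKKT
  obtain ⟨c1, d, hc1, hd, hconst⟩ := aux_const τ α hτ hα1 hα2 hτub
  obtain ⟨mx, hmx, hmx'⟩ := aux_coer
    ((1/2 : ℝ) • Sf + S + ((1/2) * (1 - α) * σ) • (A ∘ₗ Astar)) (by simpa using hHf)
  obtain ⟨my, hmy, hmy'⟩ := aux_coer
    ((1/2 : ℝ) • Sg + T + (min τ (1 + τ - τ ^ 2) * α * σ) • (B ∘ₗ Bstar)) (by simpa using hMg)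
  obtain ⟨Cx, hCx, hresx⟩ := aux_res A Bstar (Sfh + S) f' hf'lip σ τ
  obtain ⟨Cy, hCy, hresy⟩ := aux_res B (0 : Y →ₗ[ℝ] Z) (Sgh + T) g' hg'lip σ τ
  set r : ℕ → Z := fun k => Astar (xk k) + Bstar (yk k) - c with hr
  have hA2 : ∀ (x : X) (z : Z), ⟪x, A z⟫ = ⟪Astar x, z⟫ := fun x z => by
    rw [real_inner_comm, hA, real_inner_comm]
  have hB2 : ∀ (y : Y) (z : Z), ⟪y, B z⟫ = ⟪Bstar y, z⟫ := fun y z => by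
    rw [real_inner_comm, hB, real_inner_comm]
  have hG0 : ∀ u : Y, 0 ≤ ⟪u, (Sgh + T) u⟫ := fun u => by
    have h1 := hhalf u
    have h2 := hSgh_psd u
    simp only [LinearMap.add_apply, inner_add_right, real_inner_smul_right] at h1 ⊢
    linarith
  set Φ : ℕ → ℝ := fun k => (1 / (τ * σ)) * ‖zk k - zb‖ ^ 2 + ⟪xk k - xb, (Sfh + S) (xk k - xb)⟫
    + ⟪yk k - yb, (Sgh + T) (yk k - yb)⟫ + σ * ‖Bstar (yk k - yb)‖ ^ 2 with hΦ
  -- basic descent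
  have hdesc : ∀ k, ⟪xk (k+1) - xk k, (1/2 : ℝ) • Sf (xk (k+1) - xk k) + S (xk (k+1) - xk k)⟫
      + ⟪yk (k+1) - yk k, (1/2 : ℝ) • Sg (yk (k+1) - yk k) + T (yk (k+1) - yk k)⟫
      + σ * ((2 - τ) * ‖r (k+1)‖ ^ 2 - 2 * ⟪r (k+1), Bstar (yk (k+1) - yk k)⟫
        + ‖Bstar (yk (k+1) - yk k)‖ ^ 2) ≤ Φ k - Φ (k+1) := by
    intro k
    have bx := aux_block p hp_nebot f f' Sf Sfh S hSf_sym hSf_psd hSfh_sym hS_sym hf_low hf_up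
      (xk k) (xk (k+1)) xb _ _ (hxdom _) hpb (hiter_x k xb) (hkx _)
    have bY := aux_block q hq_nebot g g' Sg Sgh T hSg_sym hSg_psd hSgh_sym hT_sym hg_low hg_up
      (yk k) (yk (k+1)) yb _ _ (hydom _) hqb (hiter_y k yb) (hky _)
    have er : r (k+1) = Astar (xk (k+1) - xb) + Bstar (yk (k+1) - yb) := by
      simp only [hr, ← hc, map_sub]; abel
    have er2 : Astar (xk (k+1)) + Bstar (yk k) - c
        = Astar (xk (k+1) - xb) + Bstar (yk k - yb) := by
      simp only [← hc, map_sub]; abel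
    have er3 : Astar (xk (k+1)) + Bstar (yk (k+1)) - c = r (k+1) := rfl
    have m := aux_mult σ τ hσ hτ (Astar (xk (k+1) - xb)) (Bstar (yk (k+1) - yb))
      (Bstar (yk k - yb)) (r (k+1)) (zk k) zb er
    have eb : Bstar (yk (k+1) - yb) - Bstar (yk k - yb) = Bstar (yk (k+1) - yk k) := by
      simp only [map_sub]; abel
    have ez : zk k + (τ * σ) • r (k+1) = zk (k+1) := (hiter_z k).symm
    rw [eb, ez] at m
    rw [← map_sub, hA2, er2] at bx
    rw [← map_sub, hB2, er3] at bY
    simp only [hΦ]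
    linarith
  -- cross term
  have hcross : ∀ k, 2 * σ * (⟪r (k+2), Bstar (yk (k+2) - yk (k+1))⟫
      - (1 - τ) * ⟪Bstar (yk (k+2) - yk (k+1)), r (k+1)⟫)
      ≤ ⟪yk (k+1) - yk k, (Sgh + T) (yk (k+1) - yk k)⟫
        - ⟪yk (k+2) - yk (k+1), (Sgh + T) (yk (k+2) - yk (k+1))⟫ := by
    intro k
    obtain ⟨W, hW1, hW2, hW3, hW4⟩ := hMV (k+1) (by omega)
    simp only [Nat.add_sub_cancel] at hW4
    have h := aux_ereal _ _ _ _ (hydom _) (hq_nebot _) (hydom _) (hq_nebot _)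
      (hiter_y (k+1) (yk (k+1))) (hiter_y k (yk (k+1+1)))
    have er1 : Astar (xk (k+1)) + Bstar (yk (k+1)) - c = r (k+1) := rfl
    have er3 : Astar (xk (k+1+1)) + Bstar (yk (k+1+1)) - c = r (k+2) := rfl
    have hz := hiter_z k
    have cr := aux_cross Sgh T W hSgh_sym hT_sym hW1 hW2 hW3 hhalf (yk (k+2) - yk (k+1))
      (yk (k+1) - yk k)
    rw [er1] at h hz
    rw [er3] at h
    have e2 : g' (yk (k+1)) = g' (yk k) + W (yk (k+1) - yk k) := by rw [← hW4]; abel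
    rw [hz, e2, ← neg_sub (yk (k+1+1)) (yk (k+1)), inner_neg_left] at h
    have hcm := real_inner_comm (r (k+2)) (Bstar (yk (k+2) - yk (k+1)))
    change ⟪yk (k+2) - yk (k+1), _⟫ + -⟪yk (k+2) - yk (k+1), _⟫ ≤ 0 at h
    simp only [show k + 1 + 1 = k + 2 from rfl] at h
    generalize yk (k+2) - yk (k+1) = u at *
    generalize yk (k+1) - yk k = v at *
    simp only [inner_add_right, inner_sub_right, hB2, LinearMap.add_apply,
      real_inner_smul_right] at h cr ⊢
    rw [← hcm]
    linarith
  set Ψ : ℕ → ℝ := fun k => Φ (k+1) + c1 * σ * ‖r (k+1)‖ ^ 2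
    + α * ⟪yk (k+1) - yk k, (Sgh + T) (yk (k+1) - yk k)⟫ with hΨ
  have hα0 : 0 < α := lt_of_le_of_lt (by positivity) hα1
  have hΨ0 : ∀ k, 0 ≤ Ψ k := by
    intro k
    have i1 : 0 ≤ ⟪xk (k+1) - xb, (Sfh + S) (xk (k+1) - xb)⟫ := hfsS _
    have i2 := hG0 (yk (k+1) - yb)
    have i3 := hG0 (yk (k+1) - yk k)
    simp only [hΨ, hΦ]
    positivity
  set m := min (d * σ) (min mx my) with hm
  have hm0 : 0 < m := lt_min (mul_pos hd hσ) (lt_min hmx hmy)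
  set e : ℕ → ℝ := fun k => ‖xk (k+2) - xk (k+1)‖ ^ 2 + ‖yk (k+2) - yk (k+1)‖ ^ 2
    + ‖r (k+2)‖ ^ 2 with he
  have he0 : ∀ k, 0 ≤ e k := fun k => by simp only [he]; positivity
  have hmain : ∀ k, m * e k ≤ Ψ k - Ψ (k+1) := by
    intro k
    have er : r (k+2) - Bstar (yk (k+2) - yk (k+1)) = r (k+1) + Astar (xk (k+2) - xk (k+1)) := by
      simp only [hr, map_sub]; abel
    have h5 : ‖Astar (xk (k+2) - xk (k+1))‖ ^ 2 / 2 - ‖r (k+1)‖ ^ 2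
        ≤ ‖r (k+2)‖ ^ 2 - 2 * ⟪r (k+2), Bstar (yk (k+2) - yk (k+1))⟫
          + ‖Bstar (yk (k+2) - yk (k+1))‖ ^ 2 := by
      rw [← norm_sub_sq_real, er]
      generalize r (k+1) = s
      generalize Astar (xk (k+2) - xk (k+1)) = t
      have h := sq_nonneg ‖t + (2 : ℝ) • s‖
      rw [norm_add_sq_real, norm_smul, real_inner_smul_right] at h
      rw [norm_add_sq_real, real_inner_comm t s]
      norm_num at h
      linarith
    have h3 : 2 * ⟪Bstar (yk (k+2) - yk (k+1)), r (k+1)⟫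
        ≤ ‖r (k+1)‖ ^ 2 + ‖Bstar (yk (k+2) - yk (k+1))‖ ^ 2 := by
      have h := sq_nonneg ‖Bstar (yk (k+2) - yk (k+1)) - r (k+1)‖
      rw [norm_sub_sq_real] at h
      linarith
    have h4 : -2 * ⟪Bstar (yk (k+2) - yk (k+1)), r (k+1)⟫
        ≤ τ * ‖Bstar (yk (k+2) - yk (k+1))‖ ^ 2 + ‖r (k+1)‖ ^ 2 / τ := by
      have h := sq_nonneg ‖τ • Bstar (yk (k+2) - yk (k+1)) + r (k+1)‖
      rw [norm_add_sq_real, norm_smul, real_inner_smul_left, mul_pow, Real.norm_eq_abs,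
        sq_abs] at h
      have h' := div_nonneg h hτ.le
      have e : (τ ^ 2 * ‖Bstar (yk (k+2) - yk (k+1))‖ ^ 2
          + 2 * (τ * ⟪Bstar (yk (k+2) - yk (k+1)), r (k+1)⟫) + ‖r (k+1)‖ ^ 2) / τ
          = τ * ‖Bstar (yk (k+2) - yk (k+1))‖ ^ 2
            + 2 * ⟪Bstar (yk (k+2) - yk (k+1)), r (k+1)⟫ + ‖r (k+1)‖ ^ 2 / τ := by
        field_simp
      rw [e] at h'
      linarith
    have key := hconst σ _ _ _ _ _ _ _ _ _ _ _ _ hσ (hdesc (k+1)) (hcross k) h3 h4 h5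
    have q1 := hmx' (xk (k+2) - xk (k+1))
    have q2 := hmy' (yk (k+2) - yk (k+1))
    simp only [LinearMap.add_apply, LinearMap.smul_apply, LinearMap.comp_apply] at q1 q2
    rw [inner_add_right, real_inner_smul_right, hA2, real_inner_self_eq_norm_sq] at q1
    rw [inner_add_right, real_inner_smul_right, hB2, real_inner_self_eq_norm_sq] at q2
    have m1 : m ≤ d * σ := min_le_left _ _
    have m2 : m ≤ mx := (min_le_right _ _).trans (min_le_left _ _)
    have m3 : m ≤ my := (min_le_right _ _).trans (min_le_right _ _)
    have n1 := mul_le_mul_of_nonneg_right m1 (sq_nonneg ‖r (k+2)‖)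
    have n2 := mul_le_mul_of_nonneg_right m2 (sq_nonneg ‖xk (k+2) - xk (k+1)‖)
    have n3 := mul_le_mul_of_nonneg_right m3 (sq_nonneg ‖yk (k+2) - yk (k+1)‖)
    simp only [he, hΨ]
    simp only [show k + 1 + 1 = k + 2 from rfl] at key ⊢
    linarith
  have hsum : Summable e := by
    refine summable_of_sum_range_le (c := Ψ 0 / m) he0 (fun n => ?_)
    rw [le_div_iff₀ hm0, mul_comm, Finset.mul_sum]
    have h1 := Finset.sum_le_sum (fun k (_ : k ∈ Finset.range n) => hmain k)
    rw [Finset.sum_range_sub'] at h1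
    linarith [hΨ0 n]
  refine aux_kmin _ (fun i => by positivity) ?_
  rw [← summable_nat_add_iff 1]
  refine Summable.of_nonneg_of_le (fun i => by positivity) (fun i => ?_)
    (hsum.mul_left (Cx + Cy + 1))
  have rx := hresx p (xk (i+1)) (xk (i+1+1)) (yk (i+2) - yk (i+1)) (zk (i+1)) (zk (i+1+1)) (r (i+2))
    (Astar (xk (i+1+1)) + Bstar (yk (i+1)) - c) (hiter_z (i+1))
    (by simp only [hr, map_sub]; abel) (hiter_x (i+1))
  have ry := hresy q (yk (i+1)) (yk (i+1+1)) 0 (zk (i+1)) (zk (i+1+1)) (r (i+2))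
    (Astar (xk (i+1+1)) + Bstar (yk (i+1+1)) - c) (hiter_z (i+1))
    (by simp [hr]) (hiter_y (i+1))
  have rr : ‖Astar (xk (i+1+1)) + Bstar (yk (i+1+1)) - c‖ ^ 2 ≤ e i := by
    have : ‖Astar (xk (i+1+1)) + Bstar (yk (i+1+1)) - c‖ ^ 2 = ‖r (i+2)‖ ^ 2 := rfl
    rw [this]
    simp only [he]
    nlinarith [sq_nonneg ‖xk (i+2) - xk (i+1)‖, sq_nonneg ‖yk (i+2) - yk (i+1)‖]
  have hle : ‖yk (i+1+1) - yk (i+1)‖ ^ 2 + ‖(0 : Y)‖ ^ 2 + ‖r (i+2)‖ ^ 2 ≤ e i := by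
    simp only [he, norm_zero]
    nlinarith [sq_nonneg ‖xk (i+2) - xk (i+1)‖]
  have ry' := ry.trans (mul_le_mul_of_nonneg_left hle hCy)
  have rx' : _ ≤ Cx * e i := rx
  rw [add_mul, add_mul, one_mul]
  exact add_le_add (add_le_add rx' ry') rr
end

section
/- (Non-ergodic iteration-complexity, objective value.) Under the same hypotheses as the non-ergodic KKT-residual result, if (x̄, ȳ, z̄) is a KKT point, then √k · min_{1 ≤ i ≤ k} | (p(x^i) + f(x^i) + q(y^i) + g(y^i)) − (p(x̄) + f(x̄) + q(ȳ) + g(ȳ)) | → 0 as k → ∞; that is, the minimal absolute objective-value gap over the first k iterates is o(1/√k). -/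
open scoped RealInnerProductSpace

lemma aux_coercive {E : Type*} [NormedAddCommGroup E] [InnerProductSpace ℝ E]
    [FiniteDimensional ℝ E] (Q : E →ₗ[ℝ] E) (h : ∀ u : E, u ≠ 0 → 0 < ⟪u, Q u⟫) :
    ∃ m : ℝ, 0 < m ∧ ∀ u : E, m * ‖u‖ ^ 2 ≤ ⟪u, Q u⟫ := by
  have hQ : Continuous Q := Q.continuous_of_finiteDimensional
  have hc : Continuous (fun u : E => ⟪u, Q u⟫) := continuous_id.inner hQ
  by_cases hne : (Metric.sphere (0 : E) 1).Nonempty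
  · obtain ⟨v, hv, hmin⟩ := (isCompact_sphere (0 : E) 1).exists_isMinOn hne hc.continuousOn
    have hv1 : ‖v‖ = 1 := by simpa using hv
    have hv0 : v ≠ 0 := by
      intro h0
      simp [h0] at hv1
    refine ⟨⟪v, Q v⟫, h v hv0, fun u => ?_⟩
    by_cases hu : u = 0
    · simp [hu]
    have hn : ‖u‖ ≠ 0 := by simpa using hu
    have hs : (‖u‖⁻¹ • u) ∈ Metric.sphere (0 : E) 1 := by
      simp [norm_smul, hn]
    have := hmin hs
    simp only [Set.mem_ofPred_eq, map_smul, inner_smul_left, inner_smul_right, RCLike.conj_to_real] at this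
    calc ⟪v, Q v⟫ * ‖u‖ ^ 2 ≤ (‖u‖⁻¹ * (‖u‖⁻¹ * ⟪u, Q u⟫)) * ‖u‖ ^ 2 := by gcongr
      _ = ⟪u, Q u⟫ := by field_simp
  · refine ⟨1, one_pos, fun u => ?_⟩
    by_cases hu : u = 0
    · simp [hu]
    exfalso
    apply hne
    have hn : ‖u‖ ≠ 0 := by simpa using hu
    exact ⟨‖u‖⁻¹ • u, by simp [norm_smul, hn]⟩

lemma aux_bound {E F : Type*} [NormedAddCommGroup E] [InnerProductSpace ℝ E]
    [FiniteDimensional ℝ E] [NormedAddCommGroup F] [InnerProductSpace ℝ F] (L : E →ₗ[ℝ] F) :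
    ∃ C : ℝ, 0 ≤ C ∧ ∀ u, ‖L u‖ ≤ C * ‖u‖ :=
  ⟨‖LinearMap.toContinuousLinearMap L‖, norm_nonneg _,
    fun u => (LinearMap.toContinuousLinearMap L).le_opNorm u⟩

lemma aux_cross_s14 {E : Type*} [NormedAddCommGroup E] [InnerProductSpace ℝ E]
    (G T W : E →ₗ[ℝ] E)
    (hG : ∀ u v : E, ⟪G u, v⟫ = ⟪u, G v⟫) (hT : ∀ u v : E, ⟪T u, v⟫ = ⟪u, T v⟫)
    (hW : ∀ u v : E, ⟪W u, v⟫ = ⟪u, W v⟫) (hW0 : ∀ u : E, 0 ≤ ⟪u, W u⟫)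
    (hGW : ∀ u : E, 0 ≤ ⟪u, G u - W u⟫)
    (hh : ∀ u : E, 0 ≤ ⟪u, (1/2 : ℝ) • G u + T u⟫) (u v : E) :
    2 * (⟪u, G v⟫ + ⟪u, T v⟫ - ⟪u, W v⟫)
      ≤ (⟪u, G u⟫ + ⟪u, T u⟫) + (⟪v, G v⟫ + ⟪v, T v⟫) := by
  have h1 := hh (u - v)
  have h2 := hW0 (u + v)
  have h3 := hGW (u - v)
  have g1 : ⟪v, G u⟫ = ⟪u, G v⟫ := by rw [← hG, real_inner_comm]
  have g2 : ⟪v, T u⟫ = ⟪u, T v⟫ := by rw [← hT, real_inner_comm]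
  have g3 : ⟪v, W u⟫ = ⟪u, W v⟫ := by rw [← hW, real_inner_comm]
  have h4 := hGW (u + v)
  have h5 := hW0 (u - v)
  simp only [map_sub, map_add, inner_sub_left, inner_sub_right, inner_add_left, inner_add_right,
    inner_smul_right, g1, g2, g3] at h1 h2 h3 h4 h5
  linarith

lemma aux_step {E : Type*} [NormedAddCommGroup E] [InnerProductSpace ℝ E]
    (f : E → ℝ) (f' : E → E) (Sf Sfh S : E →ₗ[ℝ] E)
    (hSf_sym : ∀ u v : E, ⟪Sf u, v⟫ = ⟪u, Sf v⟫) (hSf_psd : ∀ u : E, 0 ≤ ⟪u, Sf u⟫)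
    (hSfh_sym : ∀ u v : E, ⟪Sfh u, v⟫ = ⟪u, Sfh v⟫)
    (hS_sym : ∀ u v : E, ⟪S u, v⟫ = ⟪u, S v⟫)
    (hf_low : ∀ x x' : E, f x' + ⟪x - x', f' x'⟫ + (1/2) * ⟪x - x', Sf (x - x')⟫ ≤ f x)
    (hf_up : ∀ x x' : E, f x ≤ f x' + ⟪x - x', f' x'⟫ + (1/2) * ⟪x - x', Sfh (x - x')⟫)
    (x0 x1 xb v w : E) (P1 Pb : ℝ)
    (h1 : P1 + ⟪x1 - xb, f' x0 + v + (Sfh (x1 - x0) + S (x1 - x0))⟫ ≤ Pb)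
    (h2 : Pb + ⟪xb - x1, f' xb + w⟫ ≤ P1) :
    ((1/2) * ⟪x1 - x0, Sf (x1 - x0)⟫ + ⟪x1 - x0, S (x1 - x0)⟫)
      + ((⟪x1 - xb, Sfh (x1 - xb)⟫ + ⟪x1 - xb, S (x1 - xb)⟫)
        - (⟪x0 - xb, Sfh (x0 - xb)⟫ + ⟪x0 - xb, S (x0 - xb)⟫))
      + 2 * (⟪x1 - xb, v⟫ - ⟪x1 - xb, w⟫) ≤ 0 := by
  have e1 := hf_low xb x0
  have e2 := hf_low x1 xb
  have e3 := hf_up x1 x0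
  have e4 := hSf_psd (x1 + x0 - (2:ℝ) • xb)
  obtain ⟨a, rfl⟩ : ∃ a, x1 = a + xb := ⟨x1 - xb, by simp⟩
  obtain ⟨b, rfl⟩ : ∃ b, x0 = b + xb := ⟨x0 - xb, by simp⟩
  have t1 : a + xb - (b + xb) = a - b := by abel
  have t2 : xb - (b + xb) = - b := by abel
  have t3 : xb - (a + xb) = - a := by abel
  have t4 : a + xb + (b + xb) - (2:ℝ) • xb = a + b := by rw [two_smul]; abel
  rw [t4] at e4
  rw [t2] at e1
  rw [t1] at e3 h1
  rw [t3] at h2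
  rw [add_sub_cancel_right] at e2 h1
  rw [t1, add_sub_cancel_right, add_sub_cancel_right]
  have g1 : ⟪b, Sf a⟫ = ⟪a, Sf b⟫ := by rw [← hSf_sym, real_inner_comm]
  have g2 : ⟪b, S a⟫ = ⟪a, S b⟫ := by rw [← hS_sym, real_inner_comm]
  have g3 : ⟪b, Sfh a⟫ = ⟪a, Sfh b⟫ := by rw [← hSfh_sym, real_inner_comm]
  simp only [map_sub, map_add, map_neg, inner_neg_left, inner_neg_right, inner_sub_left,
    inner_sub_right, inner_add_left, inner_add_right, g1, g2, g3] at *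
  linarith

lemma aux_gap_up {E : Type*} [NormedAddCommGroup E] [InnerProductSpace ℝ E]
    (f : E → ℝ) (f' : E → E) (Sf Sfh S : E →ₗ[ℝ] E)
    (hSf_psd : ∀ u : E, 0 ≤ ⟪u, Sf u⟫)
    (hf_low : ∀ x x' : E, f x' + ⟪x - x', f' x'⟫ + (1/2) * ⟪x - x', Sf (x - x')⟫ ≤ f x)
    (hf_up : ∀ x x' : E, f x ≤ f x' + ⟪x - x', f' x'⟫ + (1/2) * ⟪x - x', Sfh (x - x')⟫)
    (x0 x1 xb v : E) (P1 Pb : ℝ)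
    (h1 : P1 + ⟪x1 - xb, f' x0 + v + (Sfh (x1 - x0) + S (x1 - x0))⟫ ≤ Pb) :
    P1 + f x1 - (Pb + f xb) ≤ - ⟪x1 - xb, v⟫ + (1/2) * ⟪x1 - x0, Sfh (x1 - x0)⟫
      - ⟪x1 - xb, (Sfh + S) (x1 - x0)⟫ := by
  have e1 := hf_low xb x0
  have e3 := hf_up x1 x0
  have e4 := hSf_psd (xb - x0)
  have e5 : ⟪x1 - xb, f' x0⟫ = ⟪x1 - x0, f' x0⟫ - ⟪xb - x0, f' x0⟫ := by
    rw [← inner_sub_left]; congr 1; abel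
  rw [inner_add_right, inner_add_right] at h1
  rw [LinearMap.add_apply]
  linarith

lemma aux_olivier (a : ℕ → ℝ) (ha : ∀ i, 0 ≤ a i) (hs : Summable (fun i => a (i+1) ^ 2)) :
    Filter.Tendsto (fun k : ℕ => Real.sqrt (k : ℝ) * sInf (a '' Set.Icc 1 k))
      Filter.atTop (nhds 0) := by
  have hbdd : ∀ k, BddBelow (a '' Set.Icc 1 k) := fun k => ⟨0, by rintro _ ⟨i, -, rfl⟩; exact ha i⟩
  have hnn : ∀ k, 0 ≤ sInf (a '' Set.Icc 1 k) := fun k =>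
    Real.sInf_nonneg (by rintro _ ⟨i, -, rfl⟩; exact ha i)
  have hanti : Antitone (fun k : ℕ => (sInf (a '' Set.Icc 1 (k+1))) ^ 2) := by
    intro i j hij
    have : sInf (a '' Set.Icc 1 (j+1)) ≤ sInf (a '' Set.Icc 1 (i+1)) :=
      csInf_le_csInf (hbdd _) ⟨a 1, 1, by simp, rfl⟩
        (Set.image_mono (Set.Icc_subset_Icc_right (by omega)))
    exact pow_le_pow_left₀ (hnn _) this 2
  have hsum : Summable (fun k : ℕ => (sInf (a '' Set.Icc 1 (k+1))) ^ 2) := by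
    refine Summable.of_nonneg_of_le (fun k => sq_nonneg _) (fun k => ?_) hs
    exact pow_le_pow_left₀ (hnn _) (csInf_le (hbdd _) ⟨k+1, by simp, rfl⟩) 2
  set b : ℕ → ℝ := fun k : ℕ => (sInf (a '' Set.Icc 1 (k+1))) ^ 2 with hb
  have hS := hsum.hasSum.tendsto_sum_nat
  have hhalf : Filter.Tendsto (fun n : ℕ => n / 2) Filter.atTop Filter.atTop :=
    Nat.tendsto_div_const_atTop (by norm_num)
  have hD : Filter.Tendsto (fun n : ℕ => 2 * (∑ i ∈ Finset.range n, b i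
      - ∑ i ∈ Finset.range (n / 2), b i)) Filter.atTop (nhds 0) := by
    have := (hS.sub (hS.comp hhalf)).const_mul 2
    simpa using this
  have hsq : Filter.Tendsto (fun n : ℕ => (n : ℝ) * (sInf (a '' Set.Icc 1 n)) ^ 2)
      Filter.atTop (nhds 0) := by
    refine tendsto_of_tendsto_of_tendsto_of_le_of_le' tendsto_const_nhds hD
      (Filter.Eventually.of_forall fun n => by positivity) ?_
    filter_upwards [Filter.eventually_ge_atTop 1] with n hn
    obtain ⟨j, rfl⟩ : ∃ j, n = j + 1 := ⟨n - 1, by omega⟩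
    rw [← Finset.sum_Ico_eq_sub b (Nat.div_le_self (j+1) 2)]
    have h1 : ((Finset.Ico ((j+1)/2) (j+1)).card : ℝ) * b j ≤ ∑ i ∈ Finset.Ico ((j+1)/2) (j+1), b i := by
      rw [← nsmul_eq_mul]
      refine Finset.card_nsmul_le_sum _ _ _ fun i hi => hanti ?_
      have := (Finset.mem_Ico.1 hi).2
      omega
    rw [Nat.card_Ico] at h1
    have h2 : ((j + 1 : ℕ) : ℝ) ≤ 2 * ((j + 1 - (j+1)/2 : ℕ) : ℝ) := by
      exact_mod_cast (by omega : j + 1 ≤ 2 * (j + 1 - (j+1)/2))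
    have h3 : 0 ≤ b j := sq_nonneg _
    have h4 := mul_le_mul_of_nonneg_right h2 h3
    change ((j + 1 : ℕ) : ℝ) * b j ≤ _
    linarith
  have := (Real.continuous_sqrt.tendsto 0).comp hsq
  rw [Real.sqrt_zero] at this
  refine this.congr fun n => ?_
  simp only [Function.comp]
  rw [Real.sqrt_mul (by positivity), Real.sqrt_sq (hnn n)]

lemma aux_tel (Ψ e : ℕ → ℝ) (hΨ : ∀ n, 0 ≤ Ψ n) (he : ∀ n, 0 ≤ e n)
    (h : ∀ n, Ψ (n+1) + e n ≤ Ψ n) : Summable e ∧ ∀ n, Ψ n ≤ Ψ 0 := by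
  have hs : ∀ n, ∑ i ∈ Finset.range n, e i ≤ Ψ 0 - Ψ n := by
    intro n
    induction n with
    | zero => simp
    | succ n ih =>
      rw [Finset.sum_range_succ]
      linarith [h n]
  refine ⟨summable_of_sum_range_le (c := Ψ 0) he fun n => by linarith [hs n, hΨ n], fun n => ?_⟩
  have := Finset.sum_nonneg (fun i (_ : i ∈ Finset.range n) => he i)
  linarith [hs n]

lemma aux_ereal_s14 {E : Type*} (p : E → EReal) (hb : ∀ x, p x ≠ ⊥) (x y : E) (r : ℝ)
    (hx : p x ≠ ⊤) (hy : p y ≠ ⊤) (h : p x + (r : EReal) ≤ p y) :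
    (p x).toReal + r ≤ (p y).toReal := by
  rw [← EReal.coe_toReal hx (hb x), ← EReal.coe_toReal hy (hb y)] at h
  exact_mod_cast h

lemma aux_mix {Z : Type*} [NormedAddCommGroup Z] [InnerProductSpace ℝ Z] (τ α : ℝ)
    (hτ : 0 < τ) (hα1 : τ / min (1 + τ) (1 + τ⁻¹) < α) (hα2 : α ≤ 1) :
    ∃ κ ν : ℝ, 0 < κ ∧ 0 ≤ ν ∧ 0 < α ∧ min τ (1 + τ - τ ^ 2) * α ≤ 1 ∧ 
      ∀ (r r' b a : Z) (D : ℝ), a = r - r' - b →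
      -2 * (1 - τ) * ⟪b, r'⟫ + D ≤ -2 * ⟪r, b⟫ →
      ν * (‖r‖ ^ 2 - ‖r'‖ ^ 2) + κ * ‖r‖ ^ 2 + min τ (1 + τ - τ ^ 2) * α * ‖b‖ ^ 2
        + 1 / 2 * (1 - α) * ‖a‖ ^ 2 + α * D ≤ (2 - τ) * ‖r‖ ^ 2 + ‖b‖ ^ 2 - 2 * ⟪r, b⟫ := by
  have hτi : 0 < τ⁻¹ := inv_pos.2 hτ
  have hα0 : 0 < α := lt_trans (by positivity) hα1
  have key : ∀ r r' b a : Z, a = r - r' - b →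
      -‖r'‖ ^ 2 + 1 / 2 * ‖a‖ ^ 2 ≤ ‖r‖ ^ 2 + ‖b‖ ^ 2 - 2 * ⟪r, b⟫ := by
    intro r r' b a ha
    have h1 : ‖r - b‖ ^ 2 = ‖r‖ ^ 2 - 2 * ⟪r, b⟫ + ‖b‖ ^ 2 := norm_sub_sq_real r b
    have h2 : ‖(r - b) - r'‖ ^ 2 = ‖r - b‖ ^ 2 - 2 * ⟪r - b, r'⟫ + ‖r'‖ ^ 2 := norm_sub_sq_real _ _
    have h3 : ‖(r - b) + r'‖ ^ 2 = ‖r - b‖ ^ 2 + 2 * ⟪r - b, r'⟫ + ‖r'‖ ^ 2 := norm_add_sq_real _ _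
    have h4 : a = (r - b) - r' := by rw [ha]; abel
    rw [h4]
    nlinarith [sq_nonneg ‖(r - b) + r'‖]
  rcases le_total τ 1 with h | h
  · have hm : min (1 + τ) (1 + τ⁻¹) = 1 + τ := by
      apply min_eq_left
      have := (one_le_inv₀ hτ).2 h
      linarith
    have hm2 : min τ (1 + τ - τ ^ 2) = τ := min_eq_left (by nlinarith)
    rw [hm, div_lt_iff₀ (by positivity)] at hα1
    rw [hm2]
    refine ⟨α * (1 + τ) - τ, α * (1 - τ) + (1 - α), by linarith, by nlinarith, hα0, by nlinarith, ?_⟩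
    intro r r' b a D ha hD
    have k1 := mul_le_mul_of_nonneg_left (key r r' b a ha) (by linarith : 0 ≤ 1 - α)
    have k2 := mul_le_mul_of_nonneg_left hD hα0.le
    have h3 : ‖b - r'‖ ^ 2 = ‖b‖ ^ 2 - 2 * ⟪b, r'⟫ + ‖r'‖ ^ 2 := norm_sub_sq_real b r'
    have k3 : 0 ≤ α * (1 - τ) * ‖b - r'‖ ^ 2 := by
      have : 0 ≤ 1 - τ := by linarith
      positivity
    rw [h3] at k3
    nlinarith
  · have hi1 : τ⁻¹ ≤ 1 := inv_le_one_of_one_le₀ h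
    have hm : min (1 + τ) (1 + τ⁻¹) = 1 + τ⁻¹ := by
      apply min_eq_right
      linarith
    have hm2 : min τ (1 + τ - τ ^ 2) = 1 + τ - τ ^ 2 := min_eq_right (by nlinarith)
    rw [hm, div_lt_iff₀ (by positivity)] at hα1
    rw [hm2]
    refine ⟨α * (1 + τ⁻¹) - τ, α * (1 - τ⁻¹) + (1 - α), by linarith, by nlinarith, hα0, ?_, ?_⟩
    · have h9 : 1 + τ - τ ^ 2 ≤ 1 := by nlinarith
      linarith [mul_le_mul_of_nonneg_right h9 hα0.le]
    intro r r' b a D ha hD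
    have k1 := mul_le_mul_of_nonneg_left (key r r' b a ha) (by linarith : 0 ≤ 1 - α)
    have k2 := mul_le_mul_of_nonneg_left hD hα0.le
    have h3 : ‖τ • b + r'‖ ^ 2 = τ ^ 2 * ‖b‖ ^ 2 + 2 * (τ * ⟪b, r'⟫) + ‖r'‖ ^ 2 := by
      rw [norm_add_sq_real, norm_smul, inner_smul_left, mul_pow]; simp
    have k3 : 0 ≤ α * ((τ - 1) * τ⁻¹) * ‖τ • b + r'‖ ^ 2 := by
      have : 0 ≤ τ - 1 := by linarith
      positivity
    rw [h3] at k3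
    have k4 : α * ((τ - 1) * τ⁻¹) * (τ ^ 2 * ‖b‖ ^ 2 + 2 * (τ * ⟪b, r'⟫) + ‖r'‖ ^ 2)
      = α * (τ - 1) * (τ * ‖b‖ ^ 2 + 2 * ⟪b, r'⟫) + α * (1 - τ⁻¹) * ‖r'‖ ^ 2 := by
      field_simp
    rw [k4] at k3
    nlinarith

lemma aux_quad {E : Type*} [NormedAddCommGroup E] [InnerProductSpace ℝ E]
    [FiniteDimensional ℝ E] (G H : E →ₗ[ℝ] E) (R : ℝ) :
    ∃ C : ℝ, 0 ≤ C ∧ ∀ e d : E, ‖e‖ ≤ R → ‖d‖ ≤ 2 * R →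
      (1/2) * ⟪d, G d⟫ - ⟪e, H d⟫ ≤ C * ‖d‖ := by
  obtain ⟨c1, h1, b1⟩ := aux_bound G
  obtain ⟨c2, h2, b2⟩ := aux_bound H
  by_cases hR : 0 ≤ R
  · refine ⟨R * c1 + R * c2, by positivity, fun e d he hd => ?_⟩
    have i1 : ⟪d, G d⟫ ≤ (2 * R) * (c1 * ‖d‖) := (real_inner_le_norm _ _).trans
      (mul_le_mul hd (b1 d) (norm_nonneg _) (by positivity))
    have i2 : -⟪e, H d⟫ ≤ R * (c2 * ‖d‖) := by
      refine (neg_le_abs _).trans ((abs_real_inner_le_norm _ _).trans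
        (mul_le_mul he (b2 d) (norm_nonneg _) hR))
    linarith
  · exact ⟨0, le_rfl, fun e d he _ => absurd ((norm_nonneg e).trans he) hR⟩

set_option maxHeartbeats 1000000 in
theorem stmt14
    {X Y Z : Type*}
    [NormedAddCommGroup X] [InnerProductSpace ℝ X] [FiniteDimensional ℝ X]
    [NormedAddCommGroup Y] [InnerProductSpace ℝ Y] [FiniteDimensional ℝ Y]
    [NormedAddCommGroup Z] [InnerProductSpace ℝ Z] [FiniteDimensional ℝ Z]
    (A : Z →ₗ[ℝ] X) (Astar : X →ₗ[ℝ] Z)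
    (B : Z →ₗ[ℝ] Y) (Bstar : Y →ₗ[ℝ] Z)
    (hA : ∀ (z : Z) (x : X), ⟪A z, x⟫ = ⟪z, Astar x⟫)
    (hB : ∀ (z : Z) (y : Y), ⟪B z, y⟫ = ⟪z, Bstar y⟫)
    (c : Z) (σ τ : ℝ) (hσ : 0 < σ) (hτ : 0 < τ)
    (p : X → EReal) (q : Y → EReal)
    (hp_proper : ∃ x, p x ≠ ⊤) (hp_nebot : ∀ x, p x ≠ ⊥)
    (hq_proper : ∃ y, q y ≠ ⊤) (hq_nebot : ∀ y, q y ≠ ⊥)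
    (hp_convex : ∀ (x x' : X) (t : ℝ), 0 ≤ t → t ≤ 1 →
      p (t • x + (1 - t) • x') ≤ ((t : ℝ) : EReal) * p x + (((1 - t : ℝ)) : EReal) * p x')
    (hq_convex : ∀ (y y' : Y) (t : ℝ), 0 ≤ t → t ≤ 1 →
      q (t • y + (1 - t) • y') ≤ ((t : ℝ) : EReal) * q y + (((1 - t : ℝ)) : EReal) * q y')
    (f : X → ℝ) (g : Y → ℝ) (f' : X → X) (g' : Y → Y)
    (hf : ∀ x, HasGradientAt f (f' x) x) (hg : ∀ y, HasGradientAt g (g' y) y)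
    (hfc : ConvexOn ℝ Set.univ f) (hgc : ConvexOn ℝ Set.univ g)
    (Sf Sfh S : X →ₗ[ℝ] X) (Sg Sgh T : Y →ₗ[ℝ] Y)
    (hSf_sym : ∀ u v : X, ⟪Sf u, v⟫ = ⟪u, Sf v⟫) (hSf_psd : ∀ u : X, 0 ≤ ⟪u, Sf u⟫)
    (hSfh_sym : ∀ u v : X, ⟪Sfh u, v⟫ = ⟪u, Sfh v⟫) (hSfh_psd : ∀ u : X, 0 ≤ ⟪u, Sfh u⟫)
    (hSfh_ge : ∀ u : X, ⟪u, Sf u⟫ ≤ ⟪u, Sfh u⟫)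
    (hS_sym : ∀ u v : X, ⟪S u, v⟫ = ⟪u, S v⟫)
    (hSg_sym : ∀ u v : Y, ⟪Sg u, v⟫ = ⟪u, Sg v⟫) (hSg_psd : ∀ u : Y, 0 ≤ ⟪u, Sg u⟫)
    (hSgh_sym : ∀ u v : Y, ⟪Sgh u, v⟫ = ⟪u, Sgh v⟫) (hSgh_psd : ∀ u : Y, 0 ≤ ⟪u, Sgh u⟫)
    (hSgh_ge : ∀ u : Y, ⟪u, Sg u⟫ ≤ ⟪u, Sgh u⟫)
    (hT_sym : ∀ u v : Y, ⟪T u, v⟫ = ⟪u, T v⟫)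
    (hf_low : ∀ x x' : X, f x' + ⟪x - x', f' x'⟫ + (1/2) * ⟪x - x', Sf (x - x')⟫ ≤ f x)
    (hf_up : ∀ x x' : X, f x ≤ f x' + ⟪x - x', f' x'⟫ + (1/2) * ⟪x - x', Sfh (x - x')⟫)
    (hg_low : ∀ y y' : Y, g y' + ⟪y - y', g' y'⟫ + (1/2) * ⟪y - y', Sg (y - y')⟫ ≤ g y)
    (hg_up : ∀ y y' : Y, g y ≤ g y' + ⟪y - y', g' y'⟫ + (1/2) * ⟪y - y', Sgh (y - y')⟫)
    (xk : ℕ → X) (yk : ℕ → Y) (zk : ℕ → Z)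
    (hxdom : ∀ k, p (xk k) ≠ ⊤) (hydom : ∀ k, q (yk k) ≠ ⊤)
    (hiter_x : ∀ (k : ℕ) (x : X),
      p (xk (k + 1)) + ((⟪xk (k + 1) - x, f' (xk k)
        + A (zk k + σ • (Astar (xk (k + 1)) + Bstar (yk k) - c))
        + (Sfh (xk (k + 1) - xk k) + S (xk (k + 1) - xk k))⟫ : ℝ) : EReal) ≤ p x)
    (hiter_y : ∀ (k : ℕ) (y : Y),
      q (yk (k + 1)) + ((⟪yk (k + 1) - y, g' (yk k)
        + B (zk k + σ • (Astar (xk (k + 1)) + Bstar (yk (k + 1)) - c))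
        + (Sgh (yk (k + 1) - yk k) + T (yk (k + 1) - yk k))⟫ : ℝ) : EReal) ≤ q y)
    (hiter_z : ∀ k : ℕ, zk (k + 1) = zk k + (τ * σ) • (Astar (xk (k + 1)) + Bstar (yk (k + 1)) - c))

    (xb : X) (yb : Y) (zb : Z)
    (hxb_dom : p xb ≠ ⊤) (hyb_dom : q yb ≠ ⊤)
    (hKKT_x : ∀ x : X, p xb + ((⟪xb - x, f' xb + A zb⟫ : ℝ) : EReal) ≤ p x)
    (hKKT_y : ∀ y : Y, q yb + ((⟪yb - y, g' yb + B zb⟫ : ℝ) : EReal) ≤ q y)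
    (hKKT_c : Astar xb + Bstar yb = c)

    (hMV : ∀ k : ℕ, 1 ≤ k → ∃ W : Y →ₗ[ℝ] Y,
      (∀ u v : Y, ⟪W u, v⟫ = ⟪u, W v⟫) ∧ (∀ u : Y, 0 ≤ ⟪u, W u⟫) ∧
      (∀ u : Y, 0 ≤ ⟪u, Sgh u - W u⟫) ∧
      g' (yk k) - g' (yk (k - 1)) = W (yk k - yk (k - 1)))

    (hτub : τ < (1 + Real.sqrt 5) / 2)
    (α : ℝ) (hα1 : τ / min (1 + τ) (1 + τ⁻¹) < α) (hα2 : α ≤ 1)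

    (hf'lip : ∃ L : NNReal, LipschitzWith L f') (hg'lip : ∃ L : NNReal, LipschitzWith L g')
    (hfsS : ∀ u : X, 0 ≤ ⟪u, Sfh u + S u⟫)
    (hHf : ∀ u : X, u ≠ 0 →
      0 < ⟪u, (1/2 : ℝ) • Sf u + S u + ((1/2) * (1 - α) * σ) • A (Astar u)⟫)
    (hhalf : ∀ u : Y, 0 ≤ ⟪u, (1/2 : ℝ) • Sgh u + T u⟫)
    (hMg : ∀ u : Y, u ≠ 0 →
      0 < ⟪u, (1/2 : ℝ) • Sg u + T u + (min τ (1 + τ - τ ^ 2) * α * σ) • B (Bstar u)⟫) :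
    Filter.Tendsto (fun k : ℕ => Real.sqrt (k : ℝ) * sInf ((fun i : ℕ =>
        |((p (xk i)).toReal + f (xk i) + (q (yk i)).toReal + g (yk i))
          - ((p xb).toReal + f xb + (q yb).toReal + g yb)|) '' Set.Icc 1 k))
      Filter.atTop (nhds 0) := by
  -- residual and multiplier notation
  set r : ℕ → Z := fun k => Astar (xk k) + Bstar (yk k) - c with hr
  have hre : ∀ k, r k = Astar (xk k - xb) + Bstar (yk k - yb) := by
    intro k
    simp only [hr, map_sub, ← hKKT_c]
    abel
  have hxin : ∀ k, (p (xk (k+1))).toReal + ⟪xk (k + 1) - xb, f' (xk k)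
        + A (zk k + σ • (Astar (xk (k + 1)) + Bstar (yk k) - c))
        + (Sfh (xk (k + 1) - xk k) + S (xk (k + 1) - xk k))⟫ ≤ (p xb).toReal := fun k =>
    aux_ereal_s14 p hp_nebot _ _ _ (hxdom _) hxb_dom (hiter_x k xb)
  have hyin : ∀ k (y : Y), q y ≠ ⊤ → (q (yk (k+1))).toReal + ⟪yk (k + 1) - y, g' (yk k)
        + B (zk k + σ • r (k+1))
        + (Sgh (yk (k + 1) - yk k) + T (yk (k + 1) - yk k))⟫ ≤ (q y).toReal := fun k y hy =>
    aux_ereal_s14 q hq_nebot _ _ _ (hydom _) hy (hiter_y k y)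
  have hxK : ∀ k, (p xb).toReal + ⟪xb - xk k, f' xb + A zb⟫ ≤ (p (xk k)).toReal := fun k =>
    aux_ereal_s14 p hp_nebot _ _ _ hxb_dom (hxdom _) (hKKT_x _)
  have hyK : ∀ k, (q yb).toReal + ⟪yb - yk k, g' yb + B zb⟫ ≤ (q (yk k)).toReal := fun k =>
    aux_ereal_s14 q hq_nebot _ _ _ hyb_dom (hydom _) (hKKT_y _)
  have hvx : ∀ k, Astar (xk (k + 1)) + Bstar (yk k) - c
      = r (k+1) - Bstar (yk (k+1) - yk k) := by
    intro k
    simp only [hr, map_sub]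
    abel
  have hAi : ∀ (x : X) (z : Z), ⟪x, A z⟫ = ⟪z, Astar x⟫ := fun x z => by
    rw [real_inner_comm, hA]
  have hBi : ∀ (y : Y) (z : Z), ⟪y, B z⟫ = ⟪z, Bstar y⟫ := fun y z => by
    rw [real_inner_comm, hB]
  obtain ⟨κ, ν, hκ, hν, hα0, hmin1, hmix⟩ := aux_mix (Z := Z) τ α hτ hα1 hα2
  set mn := min τ (1 + τ - τ ^ 2) with hmn
  -- seminorms
  set qx : X → ℝ := fun u => ⟪u, Sfh u⟫ + ⟪u, S u⟫ with hqx
  set qy : Y → ℝ := fun u => ⟪u, Sgh u⟫ + ⟪u, T u⟫ with hqy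
  have hqx0 : ∀ u, 0 ≤ qx u := fun u => by
    have := hfsS u
    rwa [inner_add_right] at this
  have hqy0 : ∀ u, 0 ≤ qy u := fun u => by
    have h1 := hhalf u
    have h2 := hSgh_psd u
    rw [inner_add_right, inner_smul_right] at h1
    simp only [hqy]
    linarith
  set Φ : ℕ → ℝ := fun k => (τ * σ)⁻¹ * ‖zk k - zb‖ ^ 2 + qx (xk k - xb) + qy (yk k - yb)
    + σ * ‖Bstar (yk k - yb)‖ ^ 2 with hΦ
  -- basic descent
  have hI : ∀ k, Φ (k+1) - Φ k + ((1/2) * ⟪xk (k+1) - xk k, Sf (xk (k+1) - xk k)⟫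
        + ⟪xk (k+1) - xk k, S (xk (k+1) - xk k)⟫)
      + ((1/2) * ⟪yk (k+1) - yk k, Sg (yk (k+1) - yk k)⟫
        + ⟪yk (k+1) - yk k, T (yk (k+1) - yk k)⟫)
      + σ * ((2 - τ) * ‖r (k+1)‖ ^ 2 + ‖Bstar (yk (k+1) - yk k)‖ ^ 2
        - 2 * ⟪r (k+1), Bstar (yk (k+1) - yk k)⟫) ≤ 0 := by
    intro k
    have s1 := aux_step f f' Sf Sfh S hSf_sym hSf_psd hSfh_sym hS_sym hf_low hf_up
      (xk k) (xk (k+1)) xb _ _ _ _ (hxin k) (hxK (k+1))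
    have s2 := aux_step g g' Sg Sgh T hSg_sym hSg_psd hSgh_sym hT_sym hg_low hg_up
      (yk k) (yk (k+1)) yb _ _ _ _ (hyin k yb hyb_dom) (hyK (k+1))
    rw [hvx] at s1
    have hz : zk (k+1) - zb = (zk k - zb) + (τ * σ) • r (k+1) := by
      rw [hiter_z]; simp only [hr]; abel
    have hzz : (τ * σ)⁻¹ * ‖zk (k+1) - zb‖ ^ 2 = (τ * σ)⁻¹ * ‖zk k - zb‖ ^ 2
        + 2 * ⟪zk k, r (k+1)⟫ - 2 * ⟪zb, r (k+1)⟫ + τ * σ * ‖r (k+1)‖ ^ 2 := by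
      rw [hz, norm_add_sq_real, inner_smul_right, norm_smul, mul_pow, inner_sub_left,
        Real.norm_eq_abs, sq_abs]
      field_simp
      ring
    have hb0 : Bstar (yk k - yb) = Bstar (yk (k+1) - yb) - Bstar (yk (k+1) - yk k) := by
      rw [← map_sub]; congr 1; abel
    have hbb : ‖Bstar (yk k - yb)‖ ^ 2 = ‖Bstar (yk (k+1) - yb)‖ ^ 2
        - 2 * ⟪Bstar (yk (k+1) - yb), Bstar (yk (k+1) - yk k)⟫
        + ‖Bstar (yk (k+1) - yk k)‖ ^ 2 := by
      rw [hb0, norm_sub_sq_real]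
    have hax : Astar (xk (k+1) - xb) = r (k+1) - Bstar (yk (k+1) - yb) := by
      rw [hre]; abel
    rw [hAi, hAi, hax] at s1
    rw [hBi, hBi] at s2
    have hrr : ⟪r (k+1), r (k+1)⟫ = ‖r (k+1)‖ ^ 2 := real_inner_self_eq_norm_sq _
    have c1 : ⟪Bstar (yk (k+1) - yk k), r (k+1)⟫ = ⟪r (k+1), Bstar (yk (k+1) - yk k)⟫ :=
      real_inner_comm _ _
    have c2 : ⟪Bstar (yk (k+1) - yk k), Bstar (yk (k+1) - yb)⟫
      = ⟪Bstar (yk (k+1) - yb), Bstar (yk (k+1) - yk k)⟫ := real_inner_comm _ _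
    simp only [hΦ, hqx, hqy]
    rw [hzz, hbb]
    generalize Bstar (yk (k+1) - yk k) = b at *
    generalize Bstar (yk (k+1) - yb) = be at *
    generalize r (k+1) = rr at *
    simp only [inner_add_left, inner_sub_left, inner_smul_left, inner_sub_right,
      RCLike.conj_to_real, hrr, c1, c2] at s1 s2 ⊢
    linarith
  -- monotonicity of the y-subdifferential
  set ξ : ℕ → ℝ := fun k => qy (yk (k+1) - yk k) with hξ
  have hII : ∀ k, -2 * (1 - τ) * ⟪Bstar (yk (k+2) - yk (k+1)), r (k+1)⟫
      + σ⁻¹ * (ξ (k+1) - ξ k) ≤ -2 * ⟪r (k+2), Bstar (yk (k+2) - yk (k+1))⟫ := by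
    intro k
    have a1 := hyin (k+1) (yk (k+1)) (hydom _)
    have a2 := hyin k (yk (k+2)) (hydom _)
    obtain ⟨W, W1, W2, W3, W4⟩ := hMV (k+1) (by omega)
    rw [Nat.add_sub_cancel] at W4
    have cr := aux_cross_s14 Sgh T W hSgh_sym hT_sym W1 W2 W3 hhalf
      (yk (k+2) - yk (k+1)) (yk (k+1) - yk k)
    have hz : zk (k+1) = zk k + (τ * σ) • r (k+1) := hiter_z k
    have hg1 : g' (yk (k+1)) = g' (yk k) + W (yk (k+1) - yk k) := by rw [← W4]; abel
    have hn : yk (k+1) - yk (k+2) = -(yk (k+2) - yk (k+1)) := by abel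
    rw [show k + 1 + 1 = k + 2 from rfl] at a1
    rw [hg1, hz] at a1
    rw [hn] at a2
    simp only [hξ, hqy]
    rw [show k + 1 + 1 = k + 2 from rfl]
    have c1 : ⟪r (k+1), Bstar (yk (k+2) - yk (k+1))⟫ = ⟪Bstar (yk (k+2) - yk (k+1)), r (k+1)⟫ :=
      real_inner_comm _ _
    generalize yk (k+2) - yk (k+1) = d at *
    generalize yk (k+1) - yk k = d0 at *
    generalize r (k+2) = r2 at *
    generalize r (k+1) = r1 at *
    simp only [inner_neg_left, inner_add_right, hBi] at a1 a2
    simp only [map_neg, inner_neg_right, inner_add_left, inner_smul_left, RCLike.conj_to_real, c1] at a1 a2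
    have main : σ * (-2 * (1 - τ) * ⟪Bstar d, r1⟫) + ((⟪d, Sgh d⟫ + ⟪d, T d⟫)
        - (⟪d0, Sgh d0⟫ + ⟪d0, T d0⟫)) ≤ σ * (-2 * ⟪r2, Bstar d⟫) := by linarith
    have := mul_le_mul_of_nonneg_left main (inv_pos.2 hσ).le
    rw [mul_add, inv_mul_cancel_left₀ hσ.ne', inv_mul_cancel_left₀ hσ.ne'] at this
    exact this
  -- coercivity
  obtain ⟨mX, hmX, hcX⟩ := aux_coercive
    ((1/2 : ℝ) • Sf + S + ((1/2) * (1 - α) * σ) • (A ∘ₗ Astar)) (fun u hu => by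
      simpa using hHf u hu)
  obtain ⟨mY, hmY, hcY⟩ := aux_coercive
    ((1/2 : ℝ) • Sg + T + (mn * α * σ) • (B ∘ₗ Bstar)) (fun u hu => by
      simpa using hMg u hu)
  have hcX' : ∀ u, mX * ‖u‖ ^ 2 ≤ (1/2) * ⟪u, Sf u⟫ + ⟪u, S u⟫
      + ((1/2) * (1 - α) * σ) * ‖Astar u‖ ^ 2 := fun u => by
    have := hcX u
    simp only [LinearMap.add_apply, LinearMap.smul_apply, LinearMap.comp_apply, inner_add_right,
      inner_smul_right, hAi, real_inner_self_eq_norm_sq] at this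
    exact this
  have hcY' : ∀ u, mY * ‖u‖ ^ 2 ≤ (1/2) * ⟪u, Sg u⟫ + ⟪u, T u⟫
      + (mn * α * σ) * ‖Bstar u‖ ^ 2 := fun u => by
    have := hcY u
    simp only [LinearMap.add_apply, LinearMap.smul_apply, LinearMap.comp_apply, inner_add_right,
      inner_smul_right, hBi, real_inner_self_eq_norm_sq] at this
    exact this
  set Ψ : ℕ → ℝ := fun n => Φ (n+1) + σ * ν * ‖r (n+1)‖ ^ 2 + α * ξ n with hΨ
  set e : ℕ → ℝ := fun n => σ * κ * ‖r (n+2)‖ ^ 2 + mX * ‖xk (n+2) - xk (n+1)‖ ^ 2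
    + mY * ‖yk (n+2) - yk (n+1)‖ ^ 2 with he
  have hΦ0 : ∀ n, 0 ≤ Φ n := fun n => by
    have := hqx0 (xk n - xb)
    have := hqy0 (yk n - yb)
    simp only [hΦ]
    positivity
  have hΨΦ : ∀ n, Φ (n+1) ≤ Ψ n := fun n => by
    have : 0 ≤ ξ n := hqy0 _
    have : 0 ≤ σ * ν * ‖r (n+1)‖ ^ 2 + α * ξ n := by positivity
    simp only [hΨ]
    linarith
  obtain ⟨hsum, hbd⟩ := aux_tel Ψ e (fun n => (hΦ0 _).trans (hΨΦ n)) (fun n => by positivity)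
    (fun n => by
      have i1 := hI (n+1)
      have i2 := hmix (r (n+2)) (r (n+1)) (Bstar (yk (n+2) - yk (n+1)))
        (Astar (xk (n+2) - xk (n+1))) _ (by simp only [hr, map_sub]; abel) (hII n)
      have i3 := mul_le_mul_of_nonneg_left i2 hσ.le
      have i4 := hcX' (xk (n+2) - xk (n+1))
      have i5 := hcY' (yk (n+2) - yk (n+1))
      have i6 : σ * (α * (σ⁻¹ * (ξ (n+1) - ξ n))) = α * (ξ (n+1) - ξ n) := by
        field_simp
      simp only [hΨ, he]
      rw [show n + 1 + 1 = n + 2 from rfl] at *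
      linarith)
  -- boundedness
  have hΦb : ∀ n, Φ (n+1) ≤ Ψ 0 := fun n => (hΨΦ n).trans (hbd n)
  set M := Ψ 0 with hM
  have hM0 : 0 ≤ M := (hΦ0 _).trans (hΨΦ 0)
  have hsqb : ∀ (m C t : ℝ), 0 < m → m * t ^ 2 ≤ C → t ≤ C / m + 1 := fun m C t hm h => by
    have : t ^ 2 ≤ C / m := by rw [le_div_iff₀ hm]; linarith
    nlinarith [sq_nonneg (t - 1)]
  have hparts : ∀ n, (τ * σ)⁻¹ * ‖zk (n+1) - zb‖ ^ 2 ≤ M ∧ qx (xk (n+1) - xb) ≤ M ∧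
      qy (yk (n+1) - yb) ≤ M ∧ σ * ‖Bstar (yk (n+1) - yb)‖ ^ 2 ≤ M := fun n => by
    have h0 := hΦb n
    have h1 := hqx0 (xk (n+1) - xb)
    have h2 := hqy0 (yk (n+1) - yb)
    have h3 : 0 ≤ (τ * σ)⁻¹ * ‖zk (n+1) - zb‖ ^ 2 := by positivity
    have h4 : 0 ≤ σ * ‖Bstar (yk (n+1) - yb)‖ ^ 2 := by positivity
    simp only [hΦ] at h0
    refine ⟨?_, ?_, ?_, ?_⟩ <;> linarith
  obtain ⟨E0, hE0⟩ : ∃ E0, ∀ n, e n ≤ E0 :=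
    ⟨∑' n, e n, fun n => hsum.le_tsum n (fun j _ => by positivity)⟩
  have hrb : ∀ n, ‖r (n+2)‖ ^ 2 ≤ E0 / (σ * κ) := fun n => by
    rw [le_div_iff₀ (by positivity)]
    have h0 := hE0 n
    have : 0 ≤ mX * ‖xk (n+2) - xk (n+1)‖ ^ 2 + mY * ‖yk (n+2) - yk (n+1)‖ ^ 2 := by positivity
    simp only [he] at h0
    linarith
  have hzb : ∀ n, ‖zk (n+1)‖ ≤ M / (τ * σ)⁻¹ + 1 + ‖zb‖ := fun n => by
    have := hsqb _ _ _ (by positivity) (hparts n).1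
    have h2 : ‖zk (n+1)‖ ≤ ‖zk (n+1) - zb‖ + ‖zb‖ := by
      simpa using norm_add_le (zk (n+1) - zb) zb
    linarith
  have hyb : ∀ n, ‖yk (n+1) - yb‖ ≤ (M + M) / mY + 1 := fun n => by
    obtain ⟨-, -, h1, h2⟩ := hparts n
    apply hsqb _ _ _ hmY
    refine (hcY' _).trans ?_
    have h3 := hSg_psd (yk (n+1) - yb)
    have h4 := hSgh_ge (yk (n+1) - yb)
    have h5 : mn * α * σ * ‖Bstar (yk (n+1) - yb)‖ ^ 2 ≤ 1 * (σ * ‖Bstar (yk (n+1) - yb)‖ ^ 2) := by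
      rw [mul_assoc (mn * α)]
      exact mul_le_mul_of_nonneg_right hmin1 (by positivity)
    simp only [hqy] at h1
    linarith
  have hxb : ∀ n, ‖xk (n+2) - xb‖ ≤ (M + (σ * (E0 / (σ * κ)) + M)) / mX + 1 := fun n => by
    obtain ⟨-, h1, -, h2⟩ := hparts (n+1)
    rw [show n + 1 + 1 = n + 2 from rfl] at h1 h2
    apply hsqb _ _ _ hmX
    refine (hcX' _).trans ?_
    have h3 := hSf_psd (xk (n+2) - xb)
    have h4 := hSfh_ge (xk (n+2) - xb)
    have h6 : Astar (xk (n+2) - xb) = r (n+2) - Bstar (yk (n+2) - yb) := by rw [hre]; abel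
    have h7 : ‖Astar (xk (n+2) - xb)‖ ^ 2 ≤ 2 * ‖r (n+2)‖ ^ 2 + 2 * ‖Bstar (yk (n+2) - yb)‖ ^ 2 := by
      rw [h6]
      have := parallelogram_law_with_norm ℝ (r (n+2)) (Bstar (yk (n+2) - yb))
      nlinarith [mul_self_nonneg ‖r (n+2) + Bstar (yk (n+2) - yb)‖]
    have h5 : (1/2) * (1 - α) * σ * ‖Astar (xk (n+2) - xb)‖ ^ 2
        ≤ (1/2) * σ * ‖Astar (xk (n+2) - xb)‖ ^ 2 := by
      apply mul_le_mul_of_nonneg_right _ (by positivity)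
      nlinarith
    have h8 := mul_le_mul_of_nonneg_left h7 (by positivity : 0 ≤ (1/2) * σ)
    have h9 := mul_le_mul_of_nonneg_left (hrb n) hσ.le
    simp only [hqx] at h1
    linarith
  obtain ⟨Rz, hRz⟩ : ∃ R, ∀ n, ‖zk (n+1)‖ ≤ R := ⟨_, hzb⟩
  obtain ⟨Ry, hRy⟩ : ∃ R, ∀ n, ‖yk (n+1) - yb‖ ≤ R := ⟨_, hyb⟩
  obtain ⟨Rx, hRx⟩ : ∃ R, ∀ n, ‖xk (n+2) - xb‖ ≤ R := ⟨_, hxb⟩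
  obtain ⟨Rr, hRr⟩ : ∃ R, ∀ n, ‖r (n+2)‖ ≤ R := ⟨_, fun n => hsqb 1 _ _ one_pos (by
    rw [one_mul]; exact hrb n)⟩
  obtain ⟨Ca, hCa0, hCa⟩ := aux_bound Astar
  obtain ⟨Cb, hCb0, hCb⟩ := aux_bound Bstar
  obtain ⟨Cx, hCx0, hCx⟩ := aux_quad Sfh (Sfh + S) Rx
  obtain ⟨Cy, hCy0, hCy⟩ := aux_quad Sgh (Sgh + T) Ry
  have hRz0 : 0 ≤ Rz := (norm_nonneg _).trans (hRz 0)
  have hRx0 : 0 ≤ Rx := (norm_nonneg _).trans (hRx 0)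
  have hRr0 : 0 ≤ Rr := (norm_nonneg _).trans (hRr 0)
  set gap : ℕ → ℝ := fun i => ((p (xk i)).toReal + f (xk i) + (q (yk i)).toReal + g (yk i))
          - ((p xb).toReal + f xb + (q yb).toReal + g yb) with hgap
  have hlow : ∀ k, -(‖zb‖ * ‖r k‖) ≤ gap k := fun k => by
    have h1 := hf_low (xk k) xb
    have h2 := hg_low (yk k) yb
    have h3 := hSf_psd (xk k - xb)
    have h4 := hSg_psd (yk k - yb)
    have h5 := hxK k
    have h6 := hyK k
    have t1 : xb - xk k = -(xk k - xb) := by abel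
    have t2 : yb - yk k = -(yk k - yb) := by abel
    rw [t1, inner_neg_left, inner_add_right, hAi] at h5
    rw [t2, inner_neg_left, inner_add_right, hBi] at h6
    have h7 : ⟪zb, r k⟫ = ⟪zb, Astar (xk k - xb)⟫ + ⟪zb, Bstar (yk k - yb)⟫ := by
      rw [hre, inner_add_right]
    have h8 := real_inner_le_norm zb (r k)
    simp only [hgap]
    linarith
  have hup : ∀ n, gap (n+3) ≤ (Rz + σ * Rr) * ‖r (n+3)‖
      + (σ * (Ca * Rx) * Cb + Cy) * ‖yk (n+3) - yk (n+2)‖ + Cx * ‖xk (n+3) - xk (n+2)‖ := fun n => by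
    have s1 := aux_gap_up f f' Sf Sfh S hSf_psd hf_low hf_up
      (xk (n+2)) (xk (n+3)) xb _ _ _ (hxin (n+2))
    have s2 := aux_gap_up g g' Sg Sgh T hSg_psd hg_low hg_up
      (yk (n+2)) (yk (n+3)) yb _ _ _ (hyin (n+2) yb hyb_dom)
    rw [hvx, show n + 2 + 1 = n + 3 from rfl, hAi] at s1
    rw [show n + 2 + 1 = n + 3 from rfl, hBi] at s2
    have b1 := hCx (xk (n+3) - xb) (xk (n+3) - xk (n+2)) (hRx (n+1)) (by
      have := norm_sub_le (xk (n+3) - xb) (xk (n+2) - xb)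
      rw [sub_sub_sub_cancel_right] at this
      linarith [hRx (n+1), hRx n])
    have b2 := hCy (yk (n+3) - yb) (yk (n+3) - yk (n+2)) (hRy (n+2)) (by
      have := norm_sub_le (yk (n+3) - yb) (yk (n+2) - yb)
      rw [sub_sub_sub_cancel_right] at this
      linarith [hRy (n+2), hRy (n+1)])
    have h7 : ⟪zk (n+2) + σ • r (n+3), r (n+3)⟫ = ⟪zk (n+2) + σ • r (n+3), Astar (xk (n+3) - xb)⟫
        + ⟪zk (n+2) + σ • r (n+3), Bstar (yk (n+3) - yb)⟫ := by
      rw [← inner_add_right, ← hre]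
    have h8 : -⟪zk (n+2) + σ • r (n+3), r (n+3)⟫ ≤ (Rz + σ * Rr) * ‖r (n+3)‖ := by
      refine (neg_le_abs _).trans ((abs_real_inner_le_norm _ _).trans ?_)
      apply mul_le_mul_of_nonneg_right _ (norm_nonneg _)
      refine (norm_add_le _ _).trans (add_le_add (hRz _) ?_)
      rw [norm_smul, Real.norm_eq_abs, abs_of_pos hσ]
      exact mul_le_mul_of_nonneg_left (hRr _) hσ.le
    have h9 : ⟪Bstar (yk (n+3) - yk (n+2)), Astar (xk (n+3) - xb)⟫
        ≤ (Cb * ‖yk (n+3) - yk (n+2)‖) * (Ca * Rx) := by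
      refine (real_inner_le_norm _ _).trans ?_
      refine mul_le_mul (hCb _) ((hCa _).trans ?_) (norm_nonneg _) (by positivity)
      exact mul_le_mul_of_nonneg_left (hRx (n+1)) hCa0
    have h10 := mul_le_mul_of_nonneg_left h9 hσ.le
    have h11 : ⟪zk (n+2) + σ • (r (n+3) - Bstar (yk (n+3) - yk (n+2))), Astar (xk (n+3) - xb)⟫
        = ⟪zk (n+2) + σ • r (n+3), Astar (xk (n+3) - xb)⟫
          - σ * ⟪Bstar (yk (n+3) - yk (n+2)), Astar (xk (n+3) - xb)⟫ := by
      simp only [inner_add_left, inner_smul_left, inner_sub_left, RCLike.conj_to_real]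
      ring
    rw [h11] at s1
    simp only [hgap]
    linarith
  obtain ⟨K, hK0, hK⟩ : ∃ K, 0 ≤ K ∧ ∀ n, |gap (n+3)| ≤
      K * (‖r (n+3)‖ + ‖xk (n+3) - xk (n+2)‖ + ‖yk (n+3) - yk (n+2)‖) := by
    refine ⟨‖zb‖ + (Rz + σ * Rr) + (σ * (Ca * Rx) * Cb + Cy) + Cx, by positivity, fun n => ?_⟩
    have n1 := norm_nonneg (r (n+3))
    have n2 := norm_nonneg (xk (n+3) - xk (n+2))
    have n3 := norm_nonneg (yk (n+3) - yk (n+2))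
    have n4 := norm_nonneg zb
    have n5 : 0 ≤ Rz + σ * Rr := by positivity
    have n6 : 0 ≤ σ * (Ca * Rx) * Cb + Cy := by positivity
    have u1 := hup n
    have u2 := hlow (n+3)
    generalize Rz + σ * Rr = q1 at *
    generalize σ * (Ca * Rx) * Cb + Cy = q2 at *
    generalize ‖r (n+3)‖ = v1 at *
    generalize ‖xk (n+3) - xk (n+2)‖ = v2 at *
    generalize ‖yk (n+3) - yk (n+2)‖ = v3 at *
    generalize ‖zb‖ = q0 at *
    have m01 := mul_nonneg n4 n1
    have m02 := mul_nonneg n4 n2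
    have m03 := mul_nonneg n4 n3
    have m11 := mul_nonneg n5 n1
    have m12 := mul_nonneg n5 n2
    have m13 := mul_nonneg n5 n3
    have m21 := mul_nonneg n6 n1
    have m22 := mul_nonneg n6 n2
    have m23 := mul_nonneg n6 n3
    have m31 := mul_nonneg hCx0 n1
    have m32 := mul_nonneg hCx0 n2
    have m33 := mul_nonneg hCx0 n3
    rw [abs_le]
    constructor <;> linarith
  apply aux_olivier (fun i => |gap i|) (fun i => abs_nonneg _)
  rw [← summable_nat_add_iff 2]
  have hsum1 : Summable (fun n => e (n+1)) := (summable_nat_add_iff 1).2 hsum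
  refine Summable.of_nonneg_of_le (fun n => sq_nonneg _) (fun n => ?_)
    (hsum1.mul_left (3 * K ^ 2 * ((σ * κ)⁻¹ + mX⁻¹ + mY⁻¹)))
  have h1 := pow_le_pow_left₀ (abs_nonneg _) (hK n) 2
  rw [show n + 2 + 1 = n + 3 from rfl]
  refine h1.trans ?_
  simp only [he]
  rw [show n + 1 + 2 = n + 3 from rfl, show n + 1 + 1 = n + 2 from rfl, mul_pow]
  generalize ‖r (n+3)‖ = v1
  generalize ‖xk (n+3) - xk (n+2)‖ = v2
  generalize ‖yk (n+3) - yk (n+2)‖ = v3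
  have h2 : (v1 + v2 + v3) ^ 2 ≤ 3 * (v1 ^ 2 + v2 ^ 2 + v3 ^ 2) := by
    nlinarith [sq_nonneg (v1 - v2), sq_nonneg (v1 - v3), sq_nonneg (v2 - v3)]
  have hσκ : 0 < σ * κ := by positivity
  generalize σ * κ = s at *
  have h3 : v1 ^ 2 + v2 ^ 2 + v3 ^ 2 ≤ (s⁻¹ + mX⁻¹ + mY⁻¹) *
      (s * v1 ^ 2 + mX * v2 ^ 2 + mY * v3 ^ 2) := by
    have j1 : v1 ^ 2 = s⁻¹ * (s * v1 ^ 2) := by field_simp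
    have j2 : v2 ^ 2 = mX⁻¹ * (mX * v2 ^ 2) := by field_simp
    have j3 : v3 ^ 2 = mY⁻¹ * (mY * v3 ^ 2) := by field_simp
    have l1 : 0 ≤ s * v1 ^ 2 := by positivity
    have l2 : 0 ≤ mX * v2 ^ 2 := by positivity
    have l3 : 0 ≤ mY * v3 ^ 2 := by positivity
    have i1 : 0 < s⁻¹ := by positivity
    have i2 : 0 < mX⁻¹ := by positivity
    have i3 : 0 < mY⁻¹ := by positivity
    rw [j1, j2, j3]
    simp only [← j1, ← j2, ← j3]
    generalize s * v1 ^ 2 = w1 at *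
    generalize mX * v2 ^ 2 = w2 at *
    generalize mY * v3 ^ 2 = w3 at *
    have := mul_nonneg i1.le l2
    have := mul_nonneg i1.le l3
    have := mul_nonneg i2.le l1
    have := mul_nonneg i2.le l3
    have := mul_nonneg i3.le l1
    have := mul_nonneg i3.le l2
    linarith
  calc K ^ 2 * (v1 + v2 + v3) ^ 2 ≤ K ^ 2 * (3 * ((s⁻¹ + mX⁻¹ + mY⁻¹) *
      (s * v1 ^ 2 + mX * v2 ^ 2 + mY * v3 ^ 2))) := by
        apply mul_le_mul_of_nonneg_left _ (sq_nonneg K)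
        linarith
    _ = _ := by ring
end

section
/- (Ergodic O(1/k) iteration-complexity.) Suppose a KKT point exists, the mean-value hypothesis holds, τ ∈ (0, (1+√5)/2), and for some α ∈ (τ/min(1+τ, 1+τ⁻¹), 1]: Σ̂_f + S ⪰ 0, H_f ⪰ 0, (1/2)Σ_f + S + σAA* ≻ 0, (1/2)Σ̂_g + T ⪰ 0 and M_g ≻ 0. Define the ergodic averages x̂^k := (1/k)∑_{i=1}^k x^{i+1}, ŷ^k := (1/k)∑_{i=1}^k y^{i+1}, ẑ^k := (1/k)∑_{i=1}^k z̃^{i+1}. Then there exists a constant D ≥ 0 such that for every k ≥ 2 and every (x, y, z) ∈ X × Y × Z with ‖x − x̂^k‖² + ‖y − ŷ^k‖² + ‖z − ẑ^k‖² ≤ 1: (p(x̂^k) + q(ŷ^k)) − (p(x) + q(y)) + ⟨x̂^k − x, ∇f(x) + A z⟩ + ⟨ŷ^k − y, ∇g(y) + B z⟩ + ⟨ẑ^k − z, −(A*x + B*y − c)⟩ ≤ D/(2k), where when p(x) = +∞ or q(y) = +∞ the inequality is understood in the extended reals (it holds trivially). -/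
open scoped RealInnerProductSpace

/-- Inner products pass through the averages. -/
lemma s16_avg_inner {E : Type*} [NormedAddCommGroup E] [InnerProductSpace ℝ E]
    (u : ℕ → E) (x v : E) (k : ℕ) (hk : 1 ≤ k) :
    ⟪((k : ℝ)⁻¹ • ∑ i ∈ Finset.Icc 1 k, u i) - x, v⟫
      = (k : ℝ)⁻¹ * ∑ i ∈ Finset.Icc 1 k, ⟪u i - x, v⟫ := by
  have hk0 : (k : ℝ) ≠ 0 := by positivity
  simp only [inner_sub_left, inner_smul_left, Finset.sum_sub_distrib, sum_inner, Finset.sum_const,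
    Nat.card_Icc, nsmul_eq_mul, mul_sub]
  simp
  field_simp

/-- Averages of a bounded sequence are bounded. -/
lemma s16_avg_norm {E : Type*} [NormedAddCommGroup E] [InnerProductSpace ℝ E]
    (u : ℕ → E) (R : ℝ) (k : ℕ) (hk : 1 ≤ k) (h : ∀ i, 1 ≤ i → ‖u i‖ ≤ R) :
    ‖(k : ℝ)⁻¹ • ∑ i ∈ Finset.Icc 1 k, u i‖ ≤ R := by
  have hk0 : (0 : ℝ) < k := by positivity
  rw [norm_smul, norm_inv, Real.norm_of_nonneg hk0.le, inv_mul_le_iff₀ hk0]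
  refine (norm_sum_le _ _).trans ?_
  refine (Finset.sum_le_sum (fun i hi => h i (Finset.mem_Icc.1 hi).1)).trans ?_
  simp

/-- Jensen for the averages. -/
lemma s16_jensen {E : Type*} [NormedAddCommGroup E] [InnerProductSpace ℝ E]
    (p : E → EReal)
    (hp : ∀ (x x' : E) (t : ℝ), 0 ≤ t → t ≤ 1 →
      p (t • x + (1 - t) • x') ≤ ((t : ℝ) : EReal) * p x + (((1 - t : ℝ)) : EReal) * p x')
    (hp_nebot : ∀ x, p x ≠ ⊥)
    (u : ℕ → E) (P : ℕ → ℝ) (hP : ∀ i, p (u i) = (P i : EReal)) (k : ℕ) (hk : 1 ≤ k) :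
    p ((k : ℝ)⁻¹ • ∑ i ∈ Finset.Icc 1 k, u i)
      ≤ (((k : ℝ)⁻¹ * ∑ i ∈ Finset.Icc 1 k, P i : ℝ) : EReal) := by
  induction k, hk using Nat.le_induction with
  | base => simp [hP]
  | succ k hk ih =>
    have hk0 : (0 : ℝ) < k := by positivity
    have hk1 : ((k : ℝ) + 1) ≠ 0 := by positivity
    have ht : (0 : ℝ) ≤ (k : ℝ) / (k + 1) := by positivity
    have ht1 : (k : ℝ) / (k + 1) ≤ 1 := by rw [div_le_one (by positivity)]; linarith
    have h1 : (1 : ℝ) - (k : ℝ) / (k + 1) = (k + 1 : ℝ)⁻¹ := by field_simp; ring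
    have h2 : (k : ℝ) / (k + 1) * (k : ℝ)⁻¹ = (k + 1 : ℝ)⁻¹ := by field_simp
    have key := hp ((k : ℝ)⁻¹ • ∑ i ∈ Finset.Icc 1 k, u i) (u (k + 1)) _ ht ht1
    rw [smul_smul, h1, h2] at key
    obtain ⟨a, ha⟩ : ∃ a : ℝ, p ((k : ℝ)⁻¹ • ∑ i ∈ Finset.Icc 1 k, u i) = (a : EReal) := by
      refine ⟨_, (EReal.coe_toReal ?_ (hp_nebot _)).symm⟩
      intro h
      rw [h] at ih
      exact EReal.coe_ne_top _ (top_le_iff.1 ih)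
    rw [ha] at ih key
    have ih' := EReal.coe_le_coe_iff.1 ih
    rw [Finset.sum_Icc_succ_top (by omega), Finset.sum_Icc_succ_top (by omega), smul_add]
    push_cast [← EReal.coe_mul] 
    refine key.trans ?_
    rw [hP, ← EReal.coe_mul, ← EReal.coe_mul, ← EReal.coe_add, EReal.coe_le_coe_iff, mul_add]
    have := mul_le_mul_of_nonneg_left ih' ht
    rw [← mul_assoc, h2] at this
    linarith

/-- Coercivity of positive definite forms. -/
lemma s16_coercive {E : Type*} [NormedAddCommGroup E] [InnerProductSpace ℝ E]
    [FiniteDimensional ℝ E] (Q : E → ℝ) (hQ : Continuous Q)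
    (hs : ∀ (t : ℝ) u, Q (t • u) = t ^ 2 * Q u) (hpos : ∀ u, u ≠ 0 → 0 < Q u) :
    ∃ m : ℝ, 0 < m ∧ ∀ u, m * ‖u‖ ^ 2 ≤ Q u := by
  have h0 : Q 0 = 0 := by simpa using hs 0 0
  have : ProperSpace E := FiniteDimensional.proper ℝ E
  rcases (Metric.sphere (0 : E) 1).eq_empty_or_nonempty with he | hne
  · refine ⟨1, one_pos, fun u => ?_⟩
    have : u = 0 := by
      by_contra hu
      have : (‖u‖⁻¹ • u) ∈ Metric.sphere (0 : E) 1 := by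
        simp [norm_smul, hu]
      rw [he] at this
      exact this
    simp [this, h0]
  · obtain ⟨w, hw, hmin⟩ := (isCompact_sphere (0 : E) 1).exists_isMinOn hne hQ.continuousOn
    have hw0 : w ≠ 0 := by
      rintro rfl
      simp at hw
    refine ⟨Q w, hpos w hw0, fun u => ?_⟩
    by_cases hu : u = 0
    · simp [hu, h0]
    have hmem : (‖u‖⁻¹ • u) ∈ Metric.sphere (0 : E) 1 := by
      simp [norm_smul, hu]
    have := hmin hmem
    simp only [Set.mem_ofPred_eq, hs] at this
    have hn : 0 < ‖u‖ := norm_pos_iff.2 hu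
    have h3 := mul_le_mul_of_nonneg_right this (sq_nonneg ‖u‖)
    have : (‖u‖⁻¹ ^ 2 * Q u) * ‖u‖ ^ 2 = Q u := by field_simp
    linarith

/-- Gradient step inequality. -/
lemma s16_grad {E : Type*} [NormedAddCommGroup E] [InnerProductSpace ℝ E]
    (f : E → ℝ) (f' : E → E) (Sf Sfh S : E →ₗ[ℝ] E)
    (hSf_sym : ∀ u v : E, ⟪Sf u, v⟫ = ⟪u, Sf v⟫) (hSf_psd : ∀ u : E, 0 ≤ ⟪u, Sf u⟫)
    (hSfh_sym : ∀ u v : E, ⟪Sfh u, v⟫ = ⟪u, Sfh v⟫)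
    (hS_sym : ∀ u v : E, ⟪S u, v⟫ = ⟪u, S v⟫)
    (hf_low : ∀ x x' : E, f x' + ⟪x - x', f' x'⟫ + (1/2) * ⟪x - x', Sf (x - x')⟫ ≤ f x)
    (hf_up : ∀ x x' : E, f x ≤ f x' + ⟪x - x', f' x'⟫ + (1/2) * ⟪x - x', Sfh (x - x')⟫)
    (u v x : E) :
    ⟪v - x, f' x⟫ + 1/2 * ⟪v - x, Sfh (v - x) + S (v - x)⟫ - 1/2 * ⟪u - x, Sfh (u - x) + S (u - x)⟫
      + 1/2 * ⟪v - u, (1/2 : ℝ) • Sf (v - u) + S (v - u)⟫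
      ≤ ⟪v - x, f' u⟫ + ⟪v - x, Sfh (v - u) + S (v - u)⟫ := by
  have h1 := hf_low x u
  have h2 := hf_up v u
  have h3 := hf_low v x
  have h4 := hSf_psd ((v - x) + (u - x))
  have e1 : v - u = (v - x) - (u - x) := by abel
  have e2 : x - u = - (u - x) := by abel
  rw [e1] at h2 ⊢
  rw [e2] at h1
  have c1 : ∀ a b, ⟪a, Sf b⟫ = ⟪b, Sf a⟫ := fun a b => by rw [← hSf_sym, real_inner_comm]
  have c2 : ∀ a b, ⟪a, Sfh b⟫ = ⟪b, Sfh a⟫ := fun a b => by rw [← hSfh_sym, real_inner_comm]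
  have c3 : ∀ a b, ⟪a, S b⟫ = ⟪b, S a⟫ := fun a b => by rw [← hS_sym, real_inner_comm]
  generalize v - x = a at *
  generalize u - x = b at *
  simp only [map_sub, map_add, map_neg, inner_sub_left, inner_sub_right, inner_add_left,
    inner_add_right, inner_neg_left, inner_neg_right, inner_smul_right] at *
  rw [c1 b a] at *
  rw [c2 b a] at *
  rw [c3 b a] at *
  linarith

/-- Cross-term bound coming from the mean value operator. -/
lemma s16_cross {E : Type*} [NormedAddCommGroup E] [InnerProductSpace ℝ E]
    (Sgh T W : E →ₗ[ℝ] E)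
    (hSgh_sym : ∀ u v : E, ⟪Sgh u, v⟫ = ⟪u, Sgh v⟫)
    (hT_sym : ∀ u v : E, ⟪T u, v⟫ = ⟪u, T v⟫)
    (hW_sym : ∀ u v : E, ⟪W u, v⟫ = ⟪u, W v⟫)
    (hhalf : ∀ u : E, 0 ≤ ⟪u, (1/2 : ℝ) • Sgh u + T u⟫)
    (hW : ∀ u : E, 0 ≤ ⟪u, W u⟫) (hW2 : ∀ u : E, 0 ≤ ⟪u, Sgh u - W u⟫) (a b : E) :
    ⟪a, Sgh b + T b⟫ - ⟪a, W b⟫ ≤ 1/2 * ⟪a, Sgh a + T a⟫ + 1/2 * ⟪b, Sgh b + T b⟫ := by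
  have h1 := hhalf (a - b)
  have h2 := hW (a + b)
  have h3 := hW2 (a - b)
  have c1 : ∀ a b, ⟪a, W b⟫ = ⟪b, W a⟫ := fun a b => by rw [← hW_sym, real_inner_comm]
  have c2 : ∀ a b, ⟪a, Sgh b⟫ = ⟪b, Sgh a⟫ := fun a b => by rw [← hSgh_sym, real_inner_comm]
  have c3 : ∀ a b, ⟪a, T b⟫ = ⟪b, T a⟫ := fun a b => by rw [← hT_sym, real_inner_comm]
  simp only [map_sub, map_add, inner_sub_left, inner_sub_right, inner_add_left,
    inner_add_right, inner_smul_right] at *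
  rw [c1 b a] at *
  rw [c2 b a] at *
  rw [c3 b a] at *
  linarith

lemma s16_couple {Z : Type*} [NormedAddCommGroup Z] [InnerProductSpace ℝ Z]
    (rp zk z b yb e : Z) (σ τ : ℝ) (hσ : 0 < σ) (hτ : 0 < τ) :
    ⟪rp - e - yb, zk + σ • rp - σ • b⟫ + ⟪yb, zk + σ • rp⟫
      = (⟪rp - e, z⟫ - ⟪zk + σ • rp - z, e⟫)
        + 1 / (2 * τ * σ) * (‖zk + (τ * σ) • rp - z‖ ^ 2 - ‖zk - z‖ ^ 2)
        + σ * (1 - τ / 2) * ‖rp‖ ^ 2 - σ * ⟪rp, b⟫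
        + σ / 2 * (‖yb‖ ^ 2 - ‖yb - b‖ ^ 2 + ‖b‖ ^ 2) + σ * ⟪e, b⟫ := by
  have h : ‖zk + (τ * σ) • rp - z‖ ^ 2 - ‖zk - z‖ ^ 2
      = 2 * τ * σ * (⟪rp, zk⟫ - ⟪rp, z⟫ + τ * σ / 2 * ‖rp‖ ^ 2) := by
    have : zk + (τ * σ) • rp - z = (zk - z) + (τ * σ) • rp := by abel
    rw [this, norm_add_sq_real, inner_smul_right, real_inner_comm, inner_sub_right, norm_smul,
      mul_pow, Real.norm_eq_abs, sq_abs]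
    ring
  rw [h, ← mul_assoc, one_div, inv_mul_cancel₀ (by positivity), norm_sub_sq_real]
  simp only [inner_sub_left, inner_sub_right, inner_add_left,
    inner_add_right, inner_smul_left, inner_smul_right, real_inner_self_eq_norm_sq,
    RCLike.conj_to_real]
  rw [real_inner_comm rp e, real_inner_comm e zk, real_inner_comm e z]
  ring

/-- The parameter choice. -/
lemma s16_param {Z : Type*} [NormedAddCommGroup Z] [InnerProductSpace ℝ Z] (τ α : ℝ) (hτ : 0 < τ)
    (hα1 : τ / min (1 + τ) (1 + τ⁻¹) < α) (hα2 : α ≤ 1) :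
    0 < α ∧ min τ (1 + τ - τ ^ 2) * α ≤ 1 ∧ ∃ β δ : ℝ, 0 ≤ β ∧ 0 < δ ∧ α + 1 - τ = β + δ ∧
      ∀ r b : Z, min τ (1 + τ - τ ^ 2) * α * ‖b‖ ^ 2 - β * ‖r‖ ^ 2
        ≤ α * (‖b‖ ^ 2 - 2 * (1 - τ) * ⟪b, r⟫) - (1 - α) * ‖r‖ ^ 2 := by
  have hmin : 0 < min (1 + τ) (1 + τ⁻¹) := by positivity
  have hα : 0 < α := lt_of_le_of_lt (by positivity) hα1
  have hib : ∀ r b : Z, |⟪b, r⟫| ≤ ‖b‖ * ‖r‖ := fun r b => abs_real_inner_le_norm b r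
  rcases le_or_gt τ 1 with h1 | h1
  · have e1 : min τ (1 + τ - τ ^ 2) = τ := min_eq_left (by nlinarith)
    have e2 : min (1 + τ) (1 + τ⁻¹) = 1 + τ := min_eq_left (by
      have := (one_le_inv₀ hτ).2 h1
      linarith)
    rw [e2, div_lt_iff₀ (by positivity)] at hα1
    rw [e1]
    refine ⟨hα, by nlinarith, 1 - α * τ, α + α * τ - τ, by nlinarith, by linarith, by ring, ?_⟩
    intro r b
    have h := (abs_le.1 (hib r b)).2
    have h2 : 2 * ⟪b, r⟫ ≤ ‖b‖ ^ 2 + ‖r‖ ^ 2 := by nlinarith [sq_nonneg (‖b‖ - ‖r‖)]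
    have h3 := mul_le_mul_of_nonneg_left h2 (mul_nonneg hα.le (sub_nonneg.2 h1))
    linarith
  · have e1 : min τ (1 + τ - τ ^ 2) = 1 + τ - τ ^ 2 := min_eq_right (by nlinarith)
    have hi1 : τ⁻¹ < 1 := inv_lt_one_of_one_lt₀ h1
    have hi : τ * τ⁻¹ = 1 := mul_inv_cancel₀ hτ.ne'
    have hi0 : 0 < τ⁻¹ := by positivity
    have e2 : min (1 + τ) (1 + τ⁻¹) = 1 + τ⁻¹ := min_eq_right (by linarith)
    rw [e2, div_lt_iff₀ (by positivity)] at hα1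
    rw [e1]
    refine ⟨hα, by nlinarith [mul_pos hα (mul_pos hτ (sub_pos.2 h1))], 1 - α * τ⁻¹, α + α * τ⁻¹ - τ, by nlinarith, by linarith, by ring, ?_⟩
    intro r b
    have h := (abs_le.1 (hib r b)).1
    have h2 : -(τ * ‖b‖ ^ 2 + τ⁻¹ * ‖r‖ ^ 2) ≤ 2 * ⟪b, r⟫ := by
      have : 0 ≤ τ⁻¹ * (τ * ‖b‖ - ‖r‖) ^ 2 := by positivity
      have e : τ⁻¹ * (τ * ‖b‖ - ‖r‖) ^ 2 = τ * ‖b‖ ^ 2 + τ⁻¹ * ‖r‖ ^ 2 - 2 * (‖b‖ * ‖r‖) := by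
        field_simp
        ring
      linarith
    have h3 := mul_le_mul_of_nonneg_left h2 (mul_nonneg hα.le (sub_nonneg.2 h1.le))
    have e3 : α * (τ - 1) * -(τ * ‖b‖ ^ 2 + τ⁻¹ * ‖r‖ ^ 2)
      = -(α * (τ ^ 2 - τ) * ‖b‖ ^ 2) - α * ‖r‖ ^ 2 + α * τ⁻¹ * ‖r‖ ^ 2 := by
      field_simp
      ring
    rw [e3] at h3
    linarith

/-- Scalar lower bound on the residual. -/
lemma s16_resid {Z : Type*} [NormedAddCommGroup Z] [InnerProductSpace ℝ Z]
    (σ τ α m β δ : ℝ) (hσ : 0 < σ) (hα : 0 < α) (hα2 : α ≤ 1)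
    (hsum : α + 1 - τ = β + δ)
    (hpar : ∀ r b : Z, m * ‖b‖ ^ 2 - β * ‖r‖ ^ 2
        ≤ α * (‖b‖ ^ 2 - 2 * (1 - τ) * ⟪b, r⟫) - (1 - α) * ‖r‖ ^ 2)
    (rp r b a : Z) (hrel : rp - b = r + a) (d0 d1 : ℝ)
    (hmv : σ * ⟪b, rp⟫ ≤ (1 - τ) * σ * ⟪b, r⟫ - 1/2 * d1 + 1/2 * d0) :
    σ / 2 * (β + δ) * ‖rp‖ ^ 2 - σ / 2 * β * ‖r‖ ^ 2 + σ / 2 * m * ‖b‖ ^ 2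
      + (1 - α) * σ / 4 * ‖a‖ ^ 2 + α / 2 * d1 - α / 2 * d0
    ≤ σ * (1 - τ / 2) * ‖rp‖ ^ 2 - σ * ⟪rp, b⟫ + σ / 2 * ‖b‖ ^ 2 := by
  have h1 := hpar r b
  have h2 : ‖a‖ ^ 2 / 2 - ‖r‖ ^ 2 ≤ ‖rp‖ ^ 2 - 2 * ⟪rp, b⟫ + ‖b‖ ^ 2 := by
    rw [← norm_sub_sq_real, hrel, norm_add_sq_real]
    have : 0 ≤ ‖(2:ℝ) • r + a‖ ^ 2 := by positivity
    rw [norm_add_sq_real, norm_smul, inner_smul_left] at this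
    simp at this
    nlinarith
  have h3 := mul_le_mul_of_nonneg_left h2 (mul_nonneg (sub_nonneg.2 hα2) hσ.le)
  have h4 := mul_le_mul_of_nonneg_left hmv hα.le
  have h5 := mul_le_mul_of_nonneg_left h1 hσ.le
  rw [real_inner_comm rp b] at *
  rw [← hsum]
  linarith

lemma s16_far {E : Type*} [NormedAddCommGroup E] (u v : E) (s M : ℝ) (hs : 0 < s)
    (h : s * ‖u - v‖ ^ 2 ≤ M) : ‖u‖ ≤ ‖v‖ + (M / s + 1) := by
  have h1 : ‖u - v‖ ^ 2 ≤ M / s := by rw [le_div_iff₀ hs]; linarith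
  have h2 : ‖u‖ ≤ ‖v‖ + ‖u - v‖ := by
    have := norm_add_le v (u - v)
    rwa [add_sub_cancel] at this
  nlinarith [sq_nonneg (‖u - v‖ - 1)]

lemma s16_near {E : Type*} [NormedAddCommGroup E] (R : ℝ) (u v : E) (h1 : ‖u - v‖ ^ 2 ≤ 1)
    (h : ‖v‖ ≤ R) : ‖u‖ ≤ R + 1 := by
  have h2 : ‖u‖ ≤ ‖v‖ + ‖u - v‖ := by
    have := norm_add_le v (u - v)
    rwa [add_sub_cancel] at this
  have h3 : ‖u - v‖ ≤ 1 := by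
    by_contra hc
    push Not at hc
    nlinarith
  linarith

set_option maxHeartbeats 1000000 in
theorem stmt16
    {X Y Z : Type*}
    [NormedAddCommGroup X] [InnerProductSpace ℝ X] [FiniteDimensional ℝ X]
    [NormedAddCommGroup Y] [InnerProductSpace ℝ Y] [FiniteDimensional ℝ Y]
    [NormedAddCommGroup Z] [InnerProductSpace ℝ Z] [FiniteDimensional ℝ Z]
    (A : Z →ₗ[ℝ] X) (Astar : X →ₗ[ℝ] Z)
    (B : Z →ₗ[ℝ] Y) (Bstar : Y →ₗ[ℝ] Z)
    (hA : ∀ (z : Z) (x : X), ⟪A z, x⟫ = ⟪z, Astar x⟫)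
    (hB : ∀ (z : Z) (y : Y), ⟪B z, y⟫ = ⟪z, Bstar y⟫)
    (c : Z) (σ τ : ℝ) (hσ : 0 < σ) (hτ : 0 < τ)
    (p : X → EReal) (q : Y → EReal)
    (hp_proper : ∃ x, p x ≠ ⊤) (hp_nebot : ∀ x, p x ≠ ⊥)
    (hq_proper : ∃ y, q y ≠ ⊤) (hq_nebot : ∀ y, q y ≠ ⊥)
    (hp_convex : ∀ (x x' : X) (t : ℝ), 0 ≤ t → t ≤ 1 →
      p (t • x + (1 - t) • x') ≤ ((t : ℝ) : EReal) * p x + (((1 - t : ℝ)) : EReal) * p x')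
    (hq_convex : ∀ (y y' : Y) (t : ℝ), 0 ≤ t → t ≤ 1 →
      q (t • y + (1 - t) • y') ≤ ((t : ℝ) : EReal) * q y + (((1 - t : ℝ)) : EReal) * q y')
    (f : X → ℝ) (g : Y → ℝ) (f' : X → X) (g' : Y → Y)
    (hf : ∀ x, HasGradientAt f (f' x) x) (hg : ∀ y, HasGradientAt g (g' y) y)
    (hfc : ConvexOn ℝ Set.univ f) (hgc : ConvexOn ℝ Set.univ g)
    (Sf Sfh S : X →ₗ[ℝ] X) (Sg Sgh T : Y →ₗ[ℝ] Y)
    (hSf_sym : ∀ u v : X, ⟪Sf u, v⟫ = ⟪u, Sf v⟫) (hSf_psd : ∀ u : X, 0 ≤ ⟪u, Sf u⟫)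
    (hSfh_sym : ∀ u v : X, ⟪Sfh u, v⟫ = ⟪u, Sfh v⟫) (hSfh_psd : ∀ u : X, 0 ≤ ⟪u, Sfh u⟫)
    (hSfh_ge : ∀ u : X, ⟪u, Sf u⟫ ≤ ⟪u, Sfh u⟫)
    (hS_sym : ∀ u v : X, ⟪S u, v⟫ = ⟪u, S v⟫)
    (hSg_sym : ∀ u v : Y, ⟪Sg u, v⟫ = ⟪u, Sg v⟫) (hSg_psd : ∀ u : Y, 0 ≤ ⟪u, Sg u⟫)
    (hSgh_sym : ∀ u v : Y, ⟪Sgh u, v⟫ = ⟪u, Sgh v⟫) (hSgh_psd : ∀ u : Y, 0 ≤ ⟪u, Sgh u⟫)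
    (hSgh_ge : ∀ u : Y, ⟪u, Sg u⟫ ≤ ⟪u, Sgh u⟫)
    (hT_sym : ∀ u v : Y, ⟪T u, v⟫ = ⟪u, T v⟫)
    (hf_low : ∀ x x' : X, f x' + ⟪x - x', f' x'⟫ + (1/2) * ⟪x - x', Sf (x - x')⟫ ≤ f x)
    (hf_up : ∀ x x' : X, f x ≤ f x' + ⟪x - x', f' x'⟫ + (1/2) * ⟪x - x', Sfh (x - x')⟫)
    (hg_low : ∀ y y' : Y, g y' + ⟪y - y', g' y'⟫ + (1/2) * ⟪y - y', Sg (y - y')⟫ ≤ g y)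
    (hg_up : ∀ y y' : Y, g y ≤ g y' + ⟪y - y', g' y'⟫ + (1/2) * ⟪y - y', Sgh (y - y')⟫)
    (xk : ℕ → X) (yk : ℕ → Y) (zk : ℕ → Z)
    (hxdom : ∀ k, p (xk k) ≠ ⊤) (hydom : ∀ k, q (yk k) ≠ ⊤)
    (hiter_x : ∀ (k : ℕ) (x : X),
      p (xk (k + 1)) + ((⟪xk (k + 1) - x, f' (xk k)
        + A (zk k + σ • (Astar (xk (k + 1)) + Bstar (yk k) - c))
        + (Sfh (xk (k + 1) - xk k) + S (xk (k + 1) - xk k))⟫ : ℝ) : EReal) ≤ p x)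
    (hiter_y : ∀ (k : ℕ) (y : Y),
      q (yk (k + 1)) + ((⟪yk (k + 1) - y, g' (yk k)
        + B (zk k + σ • (Astar (xk (k + 1)) + Bstar (yk (k + 1)) - c))
        + (Sgh (yk (k + 1) - yk k) + T (yk (k + 1) - yk k))⟫ : ℝ) : EReal) ≤ q y)
    (hiter_z : ∀ k : ℕ, zk (k + 1) = zk k + (τ * σ) • (Astar (xk (k + 1)) + Bstar (yk (k + 1)) - c))

    (hKKT : ∃ (xb : X) (yb : Y) (zb : Z), p xb ≠ ⊤ ∧ q yb ≠ ⊤ ∧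
      (∀ x : X, p xb + ((⟪xb - x, f' xb + A zb⟫ : ℝ) : EReal) ≤ p x) ∧
      (∀ y : Y, q yb + ((⟪yb - y, g' yb + B zb⟫ : ℝ) : EReal) ≤ q y) ∧
      Astar xb + Bstar yb = c)

    (hMV : ∀ k : ℕ, 1 ≤ k → ∃ W : Y →ₗ[ℝ] Y,
      (∀ u v : Y, ⟪W u, v⟫ = ⟪u, W v⟫) ∧ (∀ u : Y, 0 ≤ ⟪u, W u⟫) ∧
      (∀ u : Y, 0 ≤ ⟪u, Sgh u - W u⟫) ∧
      g' (yk k) - g' (yk (k - 1)) = W (yk k - yk (k - 1)))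

    (hτub : τ < (1 + Real.sqrt 5) / 2)
    (α : ℝ) (hα1 : τ / min (1 + τ) (1 + τ⁻¹) < α) (hα2 : α ≤ 1)

    (hfsS : ∀ u : X, 0 ≤ ⟪u, Sfh u + S u⟫)
    (hHf : ∀ u : X, 0 ≤ ⟪u, (1/2 : ℝ) • Sf u + S u + ((1/2) * (1 - α) * σ) • A (Astar u)⟫)
    (hPDx : ∀ u : X, u ≠ 0 → 0 < ⟪u, (1/2 : ℝ) • Sf u + S u + σ • A (Astar u)⟫)
    (hhalf : ∀ u : Y, 0 ≤ ⟪u, (1/2 : ℝ) • Sgh u + T u⟫)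
    (hMg : ∀ u : Y, u ≠ 0 →
      0 < ⟪u, (1/2 : ℝ) • Sg u + T u + (min τ (1 + τ - τ ^ 2) * α * σ) • B (Bstar u)⟫) :
    ∃ D : ℝ, 0 ≤ D ∧ ∀ k : ℕ, 2 ≤ k → ∀ (x : X) (y : Y) (z : Z),
      ‖x - ((k : ℝ)⁻¹ • ∑ i ∈ Finset.Icc 1 k, xk (i + 1))‖ ^ 2 + ‖y - ((k : ℝ)⁻¹ • ∑ i ∈ Finset.Icc 1 k, yk (i + 1))‖ ^ 2 + ‖z - ((k : ℝ)⁻¹ • ∑ i ∈ Finset.Icc 1 k, (zk i + σ • (Astar (xk (i + 1)) + Bstar (yk (i + 1)) - c)))‖ ^ 2 ≤ 1 →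
      (p ((k : ℝ)⁻¹ • ∑ i ∈ Finset.Icc 1 k, xk (i + 1)) + q ((k : ℝ)⁻¹ • ∑ i ∈ Finset.Icc 1 k, yk (i + 1))) - (p x + q y)
        + ((⟪((k : ℝ)⁻¹ • ∑ i ∈ Finset.Icc 1 k, xk (i + 1)) - x, f' x + A z⟫ + ⟪((k : ℝ)⁻¹ • ∑ i ∈ Finset.Icc 1 k, yk (i + 1)) - y, g' y + B z⟫
            + ⟪((k : ℝ)⁻¹ • ∑ i ∈ Finset.Icc 1 k, (zk i + σ • (Astar (xk (i + 1)) + Bstar (yk (i + 1)) - c))) - z, -(Astar x + Bstar y - c)⟫ : ℝ) : EReal)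
      ≤ ((D / (2 * (k : ℝ)) : ℝ) : EReal) := by
  obtain ⟨hα, hmα, β, δ, hβ, hδ, hsum, hpar⟩ := s16_param (Z := Z) τ α hτ hα1 hα2
  set m := min τ (1 + τ - τ ^ 2) * α with hm
  -- real values of p, q along the iterates
  obtain ⟨P, hP⟩ : ∃ P : ℕ → ℝ, ∀ k, p (xk k) = (P k : EReal) :=
    ⟨fun k => (p (xk k)).toReal, fun k => (EReal.coe_toReal (hxdom k) (hp_nebot _)).symm⟩
  obtain ⟨Q, hQ⟩ : ∃ Q : ℕ → ℝ, ∀ k, q (yk k) = (Q k : EReal) :=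
    ⟨fun k => (q (yk k)).toReal, fun k => (EReal.coe_toReal (hydom k) (hq_nebot _)).symm⟩
  have hA' : ∀ (x : X) (z : Z), ⟪x, A z⟫ = ⟪Astar x, z⟫ := fun x z => by
    rw [real_inner_comm, hA, real_inner_comm]
  have hB' : ∀ (y : Y) (z : Z), ⟪y, B z⟫ = ⟪Bstar y, z⟫ := fun y z => by
    rw [real_inner_comm, hB, real_inner_comm]
  let r : ℕ → Z := fun k => Astar (xk k) + Bstar (yk k) - c
  let qx : X → ℝ := fun u => ⟪u, Sfh u + S u⟫
  let qy : Y → ℝ := fun u => ⟪u, Sgh u + T u⟫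
  let Φ : ℕ → X → Y → Z → ℝ := fun k x y z =>
    1/2 * qx (xk k - x) + 1/2 * qy (yk k - y) + σ / 2 * ‖Bstar (yk k - y)‖ ^ 2
      + 1 / (2 * τ * σ) * ‖zk k - z‖ ^ 2 + σ * ⟪Astar x + Bstar y - c, Bstar (yk k)⟫
      + σ / 2 * β * ‖r k‖ ^ 2 + α / 2 * qy (yk k - yk (k - 1))
  let L : ℕ → X → Y → Z → ℝ := fun k x y z =>
    P (k + 1) + Q (k + 1) + ⟪xk (k + 1) - x, f' x + A z⟫ + ⟪yk (k + 1) - y, g' y + B z⟫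
      + ⟪zk k + σ • (Astar (xk (k + 1)) + Bstar (yk (k + 1)) - c) - z, -(Astar x + Bstar y - c)⟫
  have hqx : ∀ u, 0 ≤ qx u := hfsS
  have hqy : ∀ u, 0 ≤ qy u := fun u => by
    have h1 := hhalf u
    have h2 := hSgh_psd u
    simp only [qy, inner_add_right, inner_smul_right] at *
    linarith
  -- the per-iteration inequality
  have hstep : ∀ (j : ℕ) (x : X) (y : Y) (z : Z) (px qv : ℝ), p x = (px : EReal) →
      q y = (qv : EReal) →
      L (j + 1) x y z - (px + qv) + σ / 2 * δ * ‖r (j + 2)‖ ^ 2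
        ≤ Φ (j + 1) x y z - Φ (j + 2) x y z := by
    intro j x y z px qv hpx hqv
    have ix := hiter_x (j + 1) x
    have iy := hiter_y (j + 1) y
    have iy1 := hiter_y (j + 1) (yk (j + 1))
    have iy2 := hiter_y j (yk (j + 1 + 1))
    rw [hP, hpx, ← EReal.coe_add, EReal.coe_le_coe_iff] at ix
    rw [hQ, hqv, ← EReal.coe_add, EReal.coe_le_coe_iff] at iy
    rw [hQ, hQ, ← EReal.coe_add, EReal.coe_le_coe_iff] at iy1 iy2
    have gx := s16_grad f f' Sf Sfh S hSf_sym hSf_psd hSfh_sym hS_sym hf_low hf_up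
      (xk (j + 1)) (xk (j + 1 + 1)) x
    have gy := s16_grad g g' Sg Sgh T hSg_sym hSg_psd hSgh_sym hT_sym hg_low hg_up
      (yk (j + 1)) (yk (j + 1 + 1)) y
    obtain ⟨W, hWs, hW0, hW1, hWe⟩ := hMV (j + 1) (by omega)
    have hcr := s16_cross Sgh T W hSgh_sym hT_sym hWs hhalf hW0 hW1
      (yk (j + 1 + 1) - yk (j + 1)) (yk (j + 1) - yk j)
    simp only [Nat.add_sub_cancel] at hWe
    -- monotonicity in y
    have hmv : σ * ⟪Bstar (yk (j + 1 + 1) - yk (j + 1)), r (j + 1 + 1)⟫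
        ≤ (1 - τ) * σ * ⟪Bstar (yk (j + 1 + 1) - yk (j + 1)), r (j + 1)⟫
          - 1/2 * qy (yk (j + 1 + 1) - yk (j + 1)) + 1/2 * qy (yk (j + 1) - yk j) := by
      have e1 : yk (j + 1) - yk (j + 1 + 1) = -(yk (j + 1 + 1) - yk (j + 1)) := by abel
      rw [e1] at iy2
      rw [← hWe] at hcr
      rw [hiter_z j] at iy1
      simp only [qy, r]
      generalize yk (j + 1 + 1) - yk (j + 1) = d at *
      generalize Astar (xk (j + 1)) + Bstar (yk (j + 1)) - c = r1 at *
      generalize Astar (xk (j + 1 + 1)) + Bstar (yk (j + 1 + 1)) - c = r2 at *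
      rw [inner_neg_left] at iy2
      simp only [inner_add_right, inner_sub_right, map_add, map_smul,
        inner_smul_right, hB'] at iy1 iy2 hcr ⊢
      linarith
    have hres := s16_resid σ τ α m β δ hσ hα hα2 hsum hpar (r (j + 1 + 1)) (r (j + 1))
      (Bstar (yk (j + 1 + 1) - yk (j + 1))) (Astar (xk (j + 1 + 1) - xk (j + 1)))
      (by simp only [r, map_sub]; abel) _ _ hmv
    have hcp := s16_couple (r (j + 1 + 1)) (zk (j + 1)) z
      (Bstar (yk (j + 1 + 1) - yk (j + 1))) (Bstar (yk (j + 1 + 1) - y))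
      (Astar x + Bstar y - c) σ τ hσ hτ
    have e2 : r (j + 1 + 1) - (Astar x + Bstar y - c) - Bstar (yk (j + 1 + 1) - y)
        = Astar (xk (j + 1 + 1) - x) := by simp only [r, map_sub]; abel
    have e3 : Bstar (yk (j + 1 + 1) - y) - Bstar (yk (j + 1 + 1) - yk (j + 1))
        = Bstar (yk (j + 1) - y) := by simp only [map_sub]; abel
    have e4 : r (j + 1 + 1) - (Astar x + Bstar y - c)
        = Astar (xk (j + 1 + 1) - x) + Bstar (yk (j + 1 + 1) - y) := by
      simp only [r, map_sub]; abel
    have e5 : zk (j + 1) + σ • (Astar (xk (j + 1 + 1)) + Bstar (yk (j + 1)) - c)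
        = zk (j + 1) + σ • r (j + 1 + 1) - σ • Bstar (yk (j + 1 + 1) - yk (j + 1)) := by
      simp only [r, map_sub, smul_sub, smul_add]; abel
    have e6 : zk (j + 1) + (τ * σ) • r (j + 1 + 1) = zk (j + 1 + 1) := (hiter_z (j + 1)).symm
    have e7 : ⟪Astar x + Bstar y - c, Bstar (yk (j + 1 + 1) - yk (j + 1))⟫
      = ⟪Astar x + Bstar y - c, Bstar (yk (j + 1 + 1))⟫
        - ⟪Astar x + Bstar y - c, Bstar (yk (j + 1))⟫ := by rw [map_sub, inner_sub_right]
    rw [e2, e3, e4, e6, e7] at hcp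
    rw [e5] at ix
    have hH := hHf (xk (j + 1 + 1) - xk (j + 1))
    have hM : 0 ≤ ⟪yk (j + 1 + 1) - yk (j + 1), (1/2 : ℝ) • Sg (yk (j + 1 + 1) - yk (j + 1))
        + T (yk (j + 1 + 1) - yk (j + 1))
        + (m * σ) • B (Bstar (yk (j + 1 + 1) - yk (j + 1)))⟫ := by
      by_cases h0 : yk (j + 1 + 1) - yk (j + 1) = 0
      · rw [h0]; simp
      · exact (hMg _ h0).le
    change P (j + 1 + 1) + Q (j + 1 + 1) + ⟪xk (j + 1 + 1) - x, f' x + A z⟫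
      + ⟪yk (j + 1 + 1) - y, g' y + B z⟫
      + ⟪zk (j + 1) + σ • r (j + 1 + 1) - z, -(Astar x + Bstar y - c)⟫ - (px + qv)
      + σ / 2 * δ * ‖r (j + 1 + 1)‖ ^ 2 ≤
      (1/2 * qx (xk (j + 1) - x) + 1/2 * qy (yk (j + 1) - y) + σ / 2 * ‖Bstar (yk (j + 1) - y)‖ ^ 2
      + 1 / (2 * τ * σ) * ‖zk (j + 1) - z‖ ^ 2 + σ * ⟪Astar x + Bstar y - c, Bstar (yk (j + 1))⟫
      + σ / 2 * β * ‖r (j + 1)‖ ^ 2 + α / 2 * qy (yk (j + 1) - yk j)) -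
      (1/2 * qx (xk (j + 1 + 1) - x) + 1/2 * qy (yk (j + 1 + 1) - y)
      + σ / 2 * ‖Bstar (yk (j + 1 + 1) - y)‖ ^ 2
      + 1 / (2 * τ * σ) * ‖zk (j + 1 + 1) - z‖ ^ 2
      + σ * ⟪Astar x + Bstar y - c, Bstar (yk (j + 1 + 1))⟫
      + σ / 2 * β * ‖r (j + 1 + 1)‖ ^ 2 + α / 2 * qy (yk (j + 1 + 1) - yk (j + 1)))
    change Q (j + 1 + 1) + ⟪yk (j + 1 + 1) - y, g' (yk (j + 1))
        + B (zk (j + 1) + σ • r (j + 1 + 1))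
        + (Sgh (yk (j + 1 + 1) - yk (j + 1)) + T (yk (j + 1 + 1) - yk (j + 1)))⟫ ≤ qv at iy
    change _ + 1/2 * qx (xk (j + 1 + 1) - x) - 1/2 * qx (xk (j + 1) - x) + _ ≤ _ at gx
    change _ + 1/2 * qy (yk (j + 1 + 1) - y) - 1/2 * qy (yk (j + 1) - y) + _ ≤ _ at gy
    clear iy1 iy2 hcr hmv hWe e2 e3 e4 e5 e6 e7
    rw [inner_neg_right]
    generalize zk (j + 1) + σ • r (j + 1 + 1) - σ • Bstar (yk (j + 1 + 1) - yk (j + 1)) = zt' at *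
    generalize hzt : zk (j + 1) + σ • r (j + 1 + 1) = zt at *
    generalize hdx : xk (j + 1 + 1) - xk (j + 1) = dx at *
    generalize hdy : yk (j + 1 + 1) - yk (j + 1) = dy at *
    generalize hxx : xk (j + 1 + 1) - x = xx at *
    generalize hyy : yk (j + 1 + 1) - y = yy at *
    generalize Astar x + Bstar y - c = e at *
    simp only [inner_add_right, inner_add_left, inner_smul_right, hA', hB',
      real_inner_self_eq_norm_sq] at ix iy gx gy hcp hres hH hM ⊢
    linarith
  -- boundedness of the iterates
  obtain ⟨xb, yb, zb, hpb, hqb, hKx, hKy, hKc⟩ := hKKT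
  have heb : Astar xb + Bstar yb - c = 0 := by rw [hKc, sub_self]
  have hpb' : p xb = ((p xb).toReal : EReal) := (EReal.coe_toReal hpb (hp_nebot _)).symm
  have hqb' : q yb = ((q yb).toReal : EReal) := (EReal.coe_toReal hqb (hq_nebot _)).symm
  have hLnn : ∀ k, 0 ≤ L k xb yb zb - ((p xb).toReal + (q yb).toReal) := by
    intro k
    have h1 := hKx (xk (k + 1))
    have h2 := hKy (yk (k + 1))
    rw [hpb', hP, ← EReal.coe_add, EReal.coe_le_coe_iff] at h1
    rw [hqb', hQ, ← EReal.coe_add, EReal.coe_le_coe_iff] at h2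
    rw [← neg_sub, inner_neg_left] at h1 h2
    simp only [L, heb, neg_zero, inner_zero_right]
    linarith
  have hdec : ∀ j, Φ (j + 1) xb yb zb + σ / 2 * δ * ‖r (j + 1)‖ ^ 2
      ≤ Φ 1 xb yb zb + σ / 2 * δ * ‖r 1‖ ^ 2 ∧ Φ (j + 1) xb yb zb ≤ Φ 1 xb yb zb := by
    have hmono : ∀ j, Φ (j + 1) xb yb zb ≤ Φ 1 xb yb zb := by
      intro j
      induction j with
      | zero => exact le_rfl
      | succ j ih =>
        have h1 := hstep j xb yb zb _ _ hpb' hqb'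
        have h2 := hLnn (j + 1)
        have h3 : 0 ≤ σ / 2 * δ * ‖r (j + 2)‖ ^ 2 := by positivity
        change Φ (j + 2) xb yb zb ≤ _
        linarith
    intro j
    refine ⟨?_, hmono j⟩
    cases j with
    | zero => exact le_rfl
    | succ j =>
      have h1 := hstep j xb yb zb _ _ hpb' hqb'
      have h2 := hLnn (j + 1)
      have h3 : 0 ≤ σ / 2 * δ * ‖r 1‖ ^ 2 := by positivity
      have h4 := hmono j
      change Φ (j + 2) xb yb zb + σ / 2 * δ * ‖r (j + 2)‖ ^ 2 ≤ _
      linarith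
  obtain ⟨K, hK0, hKb⟩ : ∃ K : ℝ, 0 ≤ K ∧ ∀ j, qx (xk (j + 1) - xb) ≤ K ∧ qy (yk (j + 1) - yb) ≤ K ∧
      ‖Bstar (yk (j + 1) - yb)‖ ^ 2 ≤ K ∧ ‖zk (j + 1) - zb‖ ^ 2 ≤ K ∧ ‖r (j + 1)‖ ^ 2 ≤ K := by
    have hall : ∀ j, 1/2 * qx (xk (j + 1) - xb) + 1/2 * qy (yk (j + 1) - yb)
        + σ / 2 * ‖Bstar (yk (j + 1) - yb)‖ ^ 2 + 1 / (2 * τ * σ) * ‖zk (j + 1) - zb‖ ^ 2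
        + σ / 2 * δ * ‖r (j + 1)‖ ^ 2 ≤ Φ 1 xb yb zb + σ / 2 * δ * ‖r 1‖ ^ 2 := by
      intro j
      refine le_trans ?_ (hdec j).1
      have h1 : 0 ≤ σ / 2 * β * ‖r (j + 1)‖ ^ 2 := by positivity
      have h2 : 0 ≤ α / 2 * qy (yk (j + 1) - yk (j + 1 - 1)) := mul_nonneg (by positivity) (hqy _)
      simp only [Φ, heb, inner_zero_left]
      linarith
    set K0 := Φ 1 xb yb zb + σ / 2 * δ * ‖r 1‖ ^ 2 with hK0
    have hsep : ∀ j, 0 ≤ 1/2 * qx (xk (j + 1) - xb) ∧ 0 ≤ 1/2 * qy (yk (j + 1) - yb) ∧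
        0 ≤ σ / 2 * ‖Bstar (yk (j + 1) - yb)‖ ^ 2 ∧ 0 ≤ 1 / (2 * τ * σ) * ‖zk (j + 1) - zb‖ ^ 2 ∧
        0 ≤ σ / 2 * δ * ‖r (j + 1)‖ ^ 2 := fun j =>
      ⟨mul_nonneg (by norm_num) (hqx _), mul_nonneg (by norm_num) (hqy _), by positivity,
        by positivity, by positivity⟩
    have hK0n : 0 ≤ K0 := by
      have := hall 0
      obtain ⟨a, b, c', d, e⟩ := hsep 0
      linarith
    have hdiv : ∀ s t : ℝ, 0 < s → s * t ≤ K0 → t ≤ K0 / s := fun s t hs h => by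
      rw [le_div_iff₀ hs]; linarith
    refine ⟨K0 / (1/2) + K0 / (σ / 2) + K0 / (1 / (2 * τ * σ)) + K0 / (σ / 2 * δ), by positivity,
      fun j => ?_⟩
    obtain ⟨a, b, c', d, e⟩ := hsep j
    have h := hall j
    have p1 : 0 ≤ K0 / (1/2) := by positivity
    have p2 : 0 ≤ K0 / (σ / 2) := by positivity
    have p3 : 0 ≤ K0 / (1 / (2 * τ * σ)) := by positivity
    have p4 : 0 ≤ K0 / (σ / 2 * δ) := by positivity
    refine ⟨?_, ?_, ?_, ?_, ?_⟩
    · have := hdiv (1/2) (qx (xk (j + 1) - xb)) (by norm_num) (by linarith)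
      linarith
    · have := hdiv (1/2) (qy (yk (j + 1) - yb)) (by norm_num) (by linarith)
      linarith
    · have := hdiv (σ / 2) (‖Bstar (yk (j + 1) - yb)‖ ^ 2) (by positivity) (by linarith)
      linarith
    · have := hdiv (1 / (2 * τ * σ)) (‖zk (j + 1) - zb‖ ^ 2) (by positivity) (by linarith)
      linarith
    · have := hdiv (σ / 2 * δ) (‖r (j + 1)‖ ^ 2) (by positivity) (by linarith)
      linarith
  have cA := Astar.continuous_of_finiteDimensional
  have cB := Bstar.continuous_of_finiteDimensional
  have cA0 := A.continuous_of_finiteDimensional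
  have cB0 := B.continuous_of_finiteDimensional
  have cS := S.continuous_of_finiteDimensional
  have cT := T.continuous_of_finiteDimensional
  have cSfh := Sfh.continuous_of_finiteDimensional
  have cSgh := Sgh.continuous_of_finiteDimensional
  obtain ⟨mx, hmx, hmx'⟩ := s16_coercive (fun u : X => qx u + σ * ‖Astar u‖ ^ 2)
    (by simp only [qx]; fun_prop)
    (fun t u => by
      simp only [qx, map_smul, norm_smul, inner_smul_left, inner_smul_right, inner_add_right,
        mul_pow, Real.norm_eq_abs, sq_abs, RCLike.conj_to_real]
      ring)
    (fun u hu => by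
      have h1 := hPDx u hu
      have h2 := hSfh_ge u
      have h3 := hSf_psd u
      simp only [qx, inner_add_right, inner_smul_right, hA', real_inner_self_eq_norm_sq] at h1 h2 h3 ⊢
      linarith)
  obtain ⟨my, hmy, hmy'⟩ := s16_coercive (fun u : Y => qy u + σ * ‖Bstar u‖ ^ 2)
    (by simp only [qy]; fun_prop)
    (fun t u => by
      simp only [qy, map_smul, norm_smul, inner_smul_left, inner_smul_right, inner_add_right,
        mul_pow, Real.norm_eq_abs, sq_abs, RCLike.conj_to_real]
      ring)
    (fun u hu => by
      have h1 := hMg u hu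
      have h2 := hSgh_ge u
      have h3 := hSg_psd u
      have h4 : m * (σ * ‖Bstar u‖ ^ 2) ≤ 1 * (σ * ‖Bstar u‖ ^ 2) :=
        mul_le_mul_of_nonneg_right hmα (by positivity)
      simp only [qy, inner_add_right, inner_smul_right, hB', real_inner_self_eq_norm_sq] at h1 h2 h3 ⊢
      linarith)
  obtain ⟨R, hR0, hRx, hRy, hRz⟩ : ∃ R : ℝ, 0 ≤ R ∧ (∀ i, 1 ≤ i → ‖xk i‖ ≤ R) ∧
      (∀ i, 1 ≤ i → ‖yk i‖ ≤ R) ∧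
      (∀ i, 1 ≤ i → ‖zk i + σ • (Astar (xk (i + 1)) + Bstar (yk (i + 1)) - c)‖ ≤ R) := by
    have bx : ∀ j, ‖xk (j + 1)‖ ≤ ‖xb‖ + ((K + σ * (4 * K)) / mx + 1) := by
      intro j
      obtain ⟨a, b, c', d, e⟩ := hKb j
      refine s16_far _ _ mx _ hmx ((hmx' _).trans ?_)
      have e1 : Astar (xk (j + 1) - xb) = r (j + 1) - Bstar (yk (j + 1) - yb) := by
        rw [← sub_zero (r (j + 1)), ← heb]
        simp only [r, map_sub]; abel
      have h2 : ‖Astar (xk (j + 1) - xb)‖ ^ 2 ≤ 4 * K := by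
        rw [e1]
        have h3 := norm_sub_le (r (j + 1)) (Bstar (yk (j + 1) - yb))
        have h4 := norm_nonneg (r (j + 1) - Bstar (yk (j + 1) - yb))
        nlinarith [sq_nonneg (‖r (j + 1)‖ - ‖Bstar (yk (j + 1) - yb)‖)]
      have h3 := mul_le_mul_of_nonneg_left h2 hσ.le
      linarith
    have bdy : ∀ j, ‖yk (j + 1)‖ ≤ ‖yb‖ + ((K + σ * K) / my + 1) := by
      intro j
      obtain ⟨a, b, c', d, e⟩ := hKb j
      refine s16_far _ _ my _ hmy ((hmy' _).trans ?_)
      have h3 := mul_le_mul_of_nonneg_left c' hσ.le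
      linarith
    have bz : ∀ j, ‖zk (j + 1) + σ • r (j + 2)‖ ≤ ‖zb‖ + (K / 1 + 1) + σ * (K + 1) := by
      intro j
      obtain ⟨a, b, c', d, e⟩ := hKb j
      obtain ⟨a1, b1, c1', d1, e1⟩ := hKb (j + 1)
      have h1 := s16_far (zk (j + 1)) zb 1 K one_pos (by rw [one_mul]; exact d)
      have h2 : ‖r (j + 2)‖ ≤ K + 1 := by
        change ‖r (j + 2)‖ ^ 2 ≤ K at e1
        nlinarith [sq_nonneg (‖r (j + 2)‖ - 1)]
      refine (norm_add_le _ _).trans ?_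
      rw [norm_smul, Real.norm_of_nonneg hσ.le]
      have h3 := mul_le_mul_of_nonneg_left h2 hσ.le
      linarith
    refine ⟨(‖xb‖ + ((K + σ * (4 * K)) / mx + 1)) + (‖yb‖ + ((K + σ * K) / my + 1))
      + (‖zb‖ + (K / 1 + 1) + σ * (K + 1)), by positivity, ?_, ?_, ?_⟩
    all_goals
      have p1 : 0 ≤ ‖xb‖ + ((K + σ * (4 * K)) / mx + 1) := by positivity
      have p2 : 0 ≤ ‖yb‖ + ((K + σ * K) / my + 1) := by positivity
      have p3 : 0 ≤ ‖zb‖ + (K / 1 + 1) + σ * (K + 1) := by positivity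
      rintro (_ | j) hj
      · omega
    · have := bx j
      linarith
    · have := bdy j
      linarith
    · have h := bz j
      change ‖zk (j + 1) + σ • r (j + 2)‖ ≤ _
      linarith
  -- the constant
  let F : X × Y × Z × Y → ℝ := fun w =>
    Φ 1 w.1 w.2.1 w.2.2.1 - σ * ⟪Astar w.1 + Bstar w.2.1 - c, Bstar w.2.2.2⟫
  have hFc : Continuous F := by
    simp only [F, Φ, qx, qy]
    fun_prop
  have pX : ProperSpace X := FiniteDimensional.proper ℝ X
  have pY : ProperSpace Y := FiniteDimensional.proper ℝ Y
  have pZ : ProperSpace Z := FiniteDimensional.proper ℝ Z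
  obtain ⟨D0, hD0⟩ := (isCompact_closedBall (0 : X × Y × Z × Y) (R + 1)).bddAbove_image
    hFc.continuousOn
  refine ⟨2 * max D0 0, by positivity, ?_⟩
  intro k hk x y z hball
  have hk1 : 1 ≤ k := by omega
  have hk0 : (0 : ℝ) < k := by positivity
  have jx := s16_jensen p hp_convex hp_nebot (fun i => xk (i + 1)) (fun i => P (i + 1))
    (fun i => hP _) k hk1
  have jy := s16_jensen q hq_convex hq_nebot (fun i => yk (i + 1)) (fun i => Q (i + 1))
    (fun i => hQ _) k hk1
  by_cases hpt : p x = ⊤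
  · rw [hpt, EReal.top_add_of_ne_bot (hq_nebot y), EReal.sub_top, EReal.bot_add]
    exact bot_le
  by_cases hqt : q y = ⊤
  · rw [hqt, EReal.add_top_of_ne_bot (hp_nebot x), EReal.sub_top, EReal.bot_add]
    exact bot_le
  obtain ⟨px, hpx⟩ : ∃ px : ℝ, p x = (px : EReal) :=
    ⟨_, (EReal.coe_toReal hpt (hp_nebot _)).symm⟩
  obtain ⟨qv, hqv⟩ : ∃ qv : ℝ, q y = (qv : EReal) :=
    ⟨_, (EReal.coe_toReal hqt (hq_nebot _)).symm⟩
  -- telescoping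
  have htel : ∀ n, 1 ≤ n → ∑ i ∈ Finset.Icc 1 n, (L i x y z - (px + qv))
      ≤ Φ 1 x y z - Φ (n + 1) x y z := by
    have hs : ∀ j, L (j + 1) x y z - (px + qv) ≤ Φ (j + 1) x y z - Φ (j + 2) x y z := fun j => by
      have h1 := hstep j x y z px qv hpx hqv
      have h3 : 0 ≤ σ / 2 * δ * ‖r (j + 2)‖ ^ 2 := by positivity
      linarith
    intro n hn
    induction n, hn using Nat.le_induction with
    | base => simpa using hs 0
    | succ n hn ih =>
      rw [Finset.sum_Icc_succ_top (by omega)]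
      have := hs n
      change _ ≤ Φ 1 x y z - Φ (n + 2) x y z
      linarith
  have hbx := s16_avg_norm (fun i => xk (i + 1)) R k hk1 (fun i hi => hRx _ (by omega))
  have hby := s16_avg_norm (fun i => yk (i + 1)) R k hk1 (fun i hi => hRy _ (by omega))
  have hbz := s16_avg_norm (fun i => zk i + σ • (Astar (xk (i + 1)) + Bstar (yk (i + 1)) - c))
    R k hk1 (fun i hi => hRz i hi)
  have ax := s16_avg_inner (fun i => xk (i + 1)) x (f' x + A z) k hk1
  have ay := s16_avg_inner (fun i => yk (i + 1)) y (g' y + B z) k hk1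
  have az := s16_avg_inner (fun i => zk i + σ • (Astar (xk (i + 1)) + Bstar (yk (i + 1)) - c)) z
    (-(Astar x + Bstar y - c)) k hk1
  rw [ax, ay, az, hpx, hqv]
  generalize (k : ℝ)⁻¹ • ∑ i ∈ Finset.Icc 1 k, xk (i + 1) = xh at *
  generalize (k : ℝ)⁻¹ • ∑ i ∈ Finset.Icc 1 k, yk (i + 1) = yh at *
  generalize (k : ℝ)⁻¹ • ∑ i ∈ Finset.Icc 1 k,
    (zk i + σ • (Astar (xk (i + 1)) + Bstar (yk (i + 1)) - c)) = zh at *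
  have nx : ‖x‖ ≤ R + 1 := s16_near R x xh (by nlinarith [sq_nonneg ‖y - yh‖, sq_nonneg ‖z - zh‖]) hbx
  have ny : ‖y‖ ≤ R + 1 := s16_near R y yh (by nlinarith [sq_nonneg ‖x - xh‖, sq_nonneg ‖z - zh‖]) hby
  have nz : ‖z‖ ≤ R + 1 := s16_near R z zh (by nlinarith [sq_nonneg ‖y - yh‖, sq_nonneg ‖x - xh‖]) hbz
  have nyk : ‖yk (k + 1)‖ ≤ R + 1 := (hRy (k + 1) (by omega)).trans (by linarith)
  have hFD : F (x, y, z, yk (k + 1)) ≤ D0 := by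
    apply hD0
    refine ⟨_, ?_, rfl⟩
    rw [mem_closedBall_zero_iff]
    simp only [Prod.norm_def, sup_le_iff]
    exact ⟨nx, ny, nz, nyk⟩
  have hΦk : σ * ⟪Astar x + Bstar y - c, Bstar (yk (k + 1))⟫ ≤ Φ (k + 1) x y z := by
    have h1 := hqx (xk (k + 1) - x)
    have h2 := hqy (yk (k + 1) - y)
    have h3 : 0 ≤ σ / 2 * ‖Bstar (yk (k + 1) - y)‖ ^ 2 := by positivity
    have h4 : 0 ≤ 1 / (2 * τ * σ) * ‖zk (k + 1) - z‖ ^ 2 := by positivity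
    have h5 : 0 ≤ σ / 2 * β * ‖r (k + 1)‖ ^ 2 := by positivity
    have h6 : 0 ≤ α / 2 * qy (yk (k + 1) - yk (k + 1 - 1)) := mul_nonneg (by positivity) (hqy _)
    simp only [Φ]
    linarith
  have hfin : ∑ i ∈ Finset.Icc 1 k, (L i x y z - (px + qv)) ≤ max D0 0 := by
    refine (htel k hk1).trans (le_trans ?_ (le_max_left _ _))
    simp only [F] at hFD
    linarith
  have hsumeq : ∑ i ∈ Finset.Icc 1 k, (L i x y z - (px + qv))
      = ∑ i ∈ Finset.Icc 1 k, P (i + 1) + ∑ i ∈ Finset.Icc 1 k, Q (i + 1)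
        + ∑ i ∈ Finset.Icc 1 k, ⟪xk (i + 1) - x, f' x + A z⟫
        + ∑ i ∈ Finset.Icc 1 k, ⟪yk (i + 1) - y, g' y + B z⟫
        + ∑ i ∈ Finset.Icc 1 k, ⟪zk i + σ • (Astar (xk (i + 1)) + Bstar (yk (i + 1)) - c) - z,
            -(Astar x + Bstar y - c)⟫ - k * (px + qv) := by
    simp only [L, Finset.sum_sub_distrib, Finset.sum_add_distrib, Finset.sum_const, Nat.card_Icc,
      nsmul_eq_mul, Nat.add_sub_cancel, mul_add]
  rw [hsumeq] at hfin
  have hfin2 := mul_le_mul_of_nonneg_left hfin (inv_nonneg.2 hk0.le)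
  have hkk : (k : ℝ)⁻¹ * (k * (px + qv)) = px + qv := by field_simp
  have hD : 2 * max D0 0 / (2 * (k : ℝ)) = (k : ℝ)⁻¹ * max D0 0 := by field_simp
  rw [hD]
  rw [mul_sub, hkk] at hfin2
  simp only [mul_add] at hfin2
  refine le_trans (add_le_add (EReal.sub_le_sub (add_le_add jx jy) le_rfl) le_rfl) ?_
  rw [← EReal.coe_add, ← EReal.coe_add, ← EReal.coe_sub, ← EReal.coe_add, EReal.coe_le_coe_iff]
  linarith
end
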